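/- As an identity of power series in q (valid for |q|<1): ∑_{n≥0} (M_ω(2,5,5n+4) − M_ω(3,5,5n+4)) q^n = −2·(q^5;q^5)_∞^4 / (q;q)_∞; equivalently, for every n ≥ 0, M_ω(2,5,5n+4) − M_ω(3,5,5n+4) = −2·c(n), where c(n) is the coefficient of q^n in (q^5;q^5)_∞^4 / (q;q)_∞. -/

import Mathlib

/-!
Common definitions: for a partition `π` of `n`,
`numParts` is the number of parts, `largestPart` the largest part,
`omegaOnes` the number of parts equal to 1, `rank` and `crank` the
Dyson rank and Andrews–Garvan crank.  `NT m j n` is the total number of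
parts over partitions of `n` with rank ≡ m (mod j), and `Mw m j n` is
the total number of ones over partitions of `n` with crank ≡ m (mod j).
`poch a q = (a; q)_∞ = ∏_{n ≥ 0} (1 - a qⁿ)`.
-/

namespace Beck

/-- number of parts of a partition -/
def numParts {n : ℕ} (π : n.Partition) : ℕ := Multiset.card π.parts

/-- largest part of a partition (0 for the empty partition) -/
def largestPart {n : ℕ} (π : n.Partition) : ℕ := π.parts.sup

/-- number of ones in a partition -/
def omegaOnes {n : ℕ} (π : n.Partition) : ℕ := π.parts.count 1

/-- number of parts strictly larger than the number of ones -/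
def muParts {n : ℕ} (π : n.Partition) : ℕ :=
  Multiset.card (π.parts.filter fun x => omegaOnes π < x)

/-- Dyson's rank: largest part minus number of parts -/
def rank {n : ℕ} (π : n.Partition) : ℤ :=
  (largestPart π : ℤ) - (numParts π : ℤ)

/-- the Andrews–Garvan crank -/
def crank {n : ℕ} (π : n.Partition) : ℤ :=
  if omegaOnes π = 0 then (largestPart π : ℤ)
  else (muParts π : ℤ) - (omegaOnes π : ℤ)

/-- `NT m j n`: total number of parts in partitions of `n` with rank ≡ m (mod j) -/
def NT (m j n : ℕ) : ℤ :=
  ∑ π : n.Partition,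
    if rank π % (j : ℤ) = (m : ℤ) % (j : ℤ) then (numParts π : ℤ) else 0

/-- `Mw m j n`: total number of ones in partitions of `n` with crank ≡ m (mod j) -/
def Mw (m j n : ℕ) : ℤ :=
  ∑ π : n.Partition,
    if crank π % (j : ℤ) = (m : ℤ) % (j : ℤ) then (omegaOnes π : ℤ) else 0

/-- `(a; q)_∞ = ∏_{n ≥ 0} (1 - a qⁿ)` -/
noncomputable def poch (a q : ℂ) : ℂ := ∏' n : ℕ, (1 - a * q ^ n)

section Proof

open PowerSeries Finset
open scoped PowerSeries.WithPiTopology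

section QPochhammer

variable {R : Type*} [CommRing R]

lemma X_pow_dvd_pow {q : R⟦X⟧} (hq : X ∣ q) (k : ℕ) : X ^ k ∣ q ^ k := pow_dvd_pow_of_dvd hq k

lemma eq_of_forall_X_pow_dvd_sub {f g : R⟦X⟧} (h : ∀ N, X ^ N ∣ f - g) : f = g := by
  ext n
  have := X_pow_dvd_iff.mp (h (n + 1)) n (by lia)
  rwa [map_sub, sub_eq_zero] at this

lemma isUnit_of_X_dvd_sub_one {f : R⟦X⟧} (hf : X ∣ f - 1) : IsUnit f := by
  rw [isUnit_iff_constantCoeff]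
  rw [X_dvd_iff, map_sub, sub_eq_zero] at hf
  simp [hf]

/-- The finite product `∏_{k < n} (1 - q^{k+1})`. -/
noncomputable def qfac (q : R⟦X⟧) (n : ℕ) : R⟦X⟧ := ∏ k ∈ range n, (1 - q * q ^ k)

lemma qfac_succ (q : R⟦X⟧) (n : ℕ) : qfac q (n + 1) = qfac q n * (1 - q * q ^ n) :=
  prod_range_succ _ _

lemma isUnit_qfac {q : R⟦X⟧} (hq : X ∣ q) (n : ℕ) : IsUnit (qfac q n) := by
  refine isUnit_iff_constantCoeff.mpr ?_
  rw [X_dvd_iff] at hq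
  simp [qfac, map_prod, hq]

variable [TopologicalSpace R]

/-- The infinite product `∏_{k ≥ 0} (1 - a qᵏ)` of formal power series. -/
noncomputable def qprod (a q : R⟦X⟧) : R⟦X⟧ := ∏' k : ℕ, (1 - a * q ^ k)

lemma multipliable_one_sub_of_X_pow_dvd {f : ℕ → R⟦X⟧} (hf : ∀ k, X ^ k ∣ f k) :
    Multipliable fun k ↦ 1 - f k := by
  simp_rw [sub_eq_add_neg]
  apply WithPiTopology.multipliable_one_add_of_tendsto_order_atTop_nhds_top
  refine ENat.tendsto_nhds_top_iff_natCast_lt.mpr fun n ↦ Filter.eventually_atTop.mpr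
    ⟨n + 1, fun m hm ↦ ?_⟩
  rw [order_neg]
  refine lt_of_lt_of_le (b := (m : ℕ∞)) (by exact_mod_cast hm) ?_
  exact le_order _ _ fun i hi ↦ X_pow_dvd_iff.mp (hf m) i (by exact_mod_cast hi)

lemma multipliable_qprod (a : R⟦X⟧) {q : R⟦X⟧} (hq : X ∣ q) :
    Multipliable fun k : ℕ ↦ 1 - a * q ^ k :=
  multipliable_one_sub_of_X_pow_dvd fun k ↦ (X_pow_dvd_pow hq k).mul_left a

variable [T2Space R]

lemma X_pow_dvd_qprod_sub_one {a q : R⟦X⟧} (hq : X ∣ q) {N : ℕ} (ha : X ^ N ∣ a) :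
    X ^ N ∣ qprod a q - 1 := by
  rw [X_pow_dvd_iff]
  intro d hd
  have h := (multipliable_qprod a hq).hasProd.tendsto_prod_nat
  rw [WithPiTopology.tendsto_iff_coeff_tendsto] at h
  have h1 : ∀ n, coeff d (∏ k ∈ range n, (1 - a * q ^ k)) = coeff d 1 := by
    intro n
    rw [← sub_eq_zero, ← map_sub]
    refine X_pow_dvd_iff.mp ?_ d hd
    induction n with
    | zero => simp
    | succ n ih =>
      rw [prod_range_succ, show ∀ p t : R⟦X⟧, p * (1 - t) - 1 = (p - 1) - p * t by intros; ring]
      exact dvd_sub ih ((ha.mul_right _).mul_left _)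
  have h2 := h d
  simp_rw [h1] at h2
  rw [map_sub, sub_eq_zero]
  exact tendsto_nhds_unique h2 tendsto_const_nhds

lemma isUnit_qprod {a q : R⟦X⟧} (hq : X ∣ q) (ha : X ∣ a) : IsUnit (qprod a q) :=
  isUnit_of_X_dvd_sub_one (by simpa using X_pow_dvd_qprod_sub_one (N := 1) hq (by simpa using ha))

variable [IsTopologicalRing R]

lemma tprod_one_sub_eq {f : ℕ → R⟦X⟧} (hf : ∀ k, X ^ k ∣ f k) (N : ℕ) :
    ∏' k, (1 - f k) = (∏ k ∈ range N, (1 - f k)) * ∏' k, (1 - f (k + N)) := by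
  refine (Multipliable.prod_mul_tprod_nat_mul' (f := fun k ↦ 1 - f k) ?_).symm
  exact multipliable_one_sub_of_X_pow_dvd fun k ↦ (pow_dvd_pow _ (by lia)).trans (hf (k + N))

lemma qprod_eq_prod_mul (a : R⟦X⟧) {q : R⟦X⟧} (hq : X ∣ q) (N : ℕ) :
    qprod a q = (∏ k ∈ range N, (1 - a * q ^ k)) * qprod (a * q ^ N) q := by
  rw [qprod, tprod_one_sub_eq (fun k ↦ (X_pow_dvd_pow hq k).mul_left a) N, qprod]
  congr 2
  ext1 k
  rw [pow_add]
  ring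

lemma qprod_eq_one_sub_mul (a : R⟦X⟧) {q : R⟦X⟧} (hq : X ∣ q) :
    qprod a q = (1 - a) * qprod (a * q) q := by
  simpa using qprod_eq_prod_mul a hq 1

lemma X_pow_dvd_qprod_sub_prod (a : R⟦X⟧) {q : R⟦X⟧} (hq : X ∣ q) (N : ℕ) :
    X ^ N ∣ qprod a q - ∏ k ∈ range N, (1 - a * q ^ k) := by
  rw [qprod_eq_prod_mul a hq N, ← mul_sub_one]
  exact (X_pow_dvd_qprod_sub_one hq ((X_pow_dvd_pow hq N).mul_left a)).mul_left _

end QPochhammer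

section JacobiTripleProduct

/-- Gaussian binomial coefficients evaluated at `q`. -/
def qbinom {S : Type*} [CommRing S] (q : S) : ℕ → ℕ → S
  | _, 0 => 1
  | 0, _ + 1 => 0
  | n + 1, k + 1 => qbinom q n k + q ^ (k + 1) * qbinom q n (k + 1)

/-- The `k`-th term `(-1)ᵏ a^{k(k+1)/2} b^{k(k-1)/2}` of the Jacobi triple product series. -/
def thetaTerm {S : Type*} [CommRing S] (a b : S) (k : ℤ) : S :=
  (k.negOnePow : ℤ) * (a ^ (k * (k + 1) / 2).toNat * b ^ (k * (k - 1) / 2).toNat)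

section Algebra

variable {S : Type*} [CommRing S]

@[simp] lemma qbinom_zero_right (q : S) (n : ℕ) : qbinom q n 0 = 1 := by
  cases n <;> rfl

lemma qbinom_succ_succ (q : S) (n k : ℕ) :
    qbinom q (n + 1) (k + 1) = qbinom q n k + q ^ (k + 1) * qbinom q n (k + 1) := rfl

lemma qbinom_eq_zero_of_lt (q : S) {n k : ℕ} (h : n < k) : qbinom q n k = 0 := by
  induction n generalizing k with
  | zero => obtain ⟨k, rfl⟩ := Nat.exists_eq_add_one_of_ne_zero (by lia : k ≠ 0); rfl
  | succ n ih =>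
    obtain ⟨k, rfl⟩ := Nat.exists_eq_add_one_of_ne_zero (by lia : k ≠ 0)
    rw [qbinom_succ_succ, ih (by lia), ih (by lia)]
    simp

lemma two_mul_triangle (k : ℤ) : 2 * (((k * (k + 1) / 2).toNat : ℕ) : ℤ) = k * (k + 1) := by
  have h : 0 ≤ k * (k + 1) := by
    rcases lt_or_ge k 0 with h | h
    · nlinarith
    · positivity
  have h2 := Int.even_mul_succ_self k
  rw [Int.toNat_of_nonneg (by lia), Int.two_mul_ediv_two_of_even h2]

lemma two_mul_triangle' (k : ℤ) : 2 * (((k * (k - 1) / 2).toNat : ℕ) : ℤ) = k * (k - 1) := by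
  have := two_mul_triangle (k - 1)
  rw [sub_add_cancel, mul_comm (k - 1) k] at this
  exact this

lemma mul_pow_mul_thetaTerm (a b : S) (n j : ℕ) :
    b * (a * b) ^ n * thetaTerm a b (j - n) = -(a * b) ^ j * thetaTerm a b (j - (n + 1)) := by
  have h : ((j - n : ℤ)).negOnePow = -(j - (n + 1) : ℤ).negOnePow := by
    rw [← Int.negOnePow_succ]; congr 1; ring
  have e1 := two_mul_triangle (j - n)
  have e2 := two_mul_triangle' (j - n)
  have e3 := two_mul_triangle (j - (n + 1))
  have e4 := two_mul_triangle' (j - (n + 1))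
  simp only [thetaTerm, h]
  set A := ((j - n : ℤ) * ((j - n : ℤ) + 1) / 2).toNat
  set B := ((j - n : ℤ) * ((j - n : ℤ) - 1) / 2).toNat
  set A' := ((j - (n + 1) : ℤ) * ((j - (n + 1) : ℤ) + 1) / 2).toNat
  set B' := ((j - (n + 1) : ℤ) * ((j - (n + 1) : ℤ) - 1) / 2).toNat
  have hA : n + A = j + A' := by zify; linarith
  have hB : 1 + n + B = j + B' := by zify; linarith
  calc _ = -(((j - (n + 1) : ℤ).negOnePow : ℤ) : S) * (a ^ (n + A) * b ^ (1 + n + B)) := by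
        push_cast; ring
    _ = _ := by rw [hA, hB]; ring

lemma prod_one_sub_eq_sum_qbinom (a q : S) (m : ℕ) :
    ∏ k ∈ range m, (1 - a * q ^ k) =
      ∑ j ∈ range (m + 1), qbinom q m j * ((-a) ^ j * q ^ j.choose 2) := by
  induction m generalizing a with
  | zero => simp
  | succ m ih =>
    have h : ∏ k ∈ range m, (1 - a * q ^ (k + 1)) = ∏ k ∈ range m, (1 - a * q * q ^ k) :=
      prod_congr rfl fun k _ ↦ by ring
    rw [prod_range_succ', h, ih, sum_range_succ' _ (m + 1), pow_zero, mul_one]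
    have h1 : ∑ j ∈ range (m + 1), qbinom q m j * ((-(a * q)) ^ j * q ^ j.choose 2) =
        ∑ j ∈ range (m + 1), q ^ (j + 1) * qbinom q m (j + 1) *
          ((-a) ^ (j + 1) * q ^ (j + 1).choose 2) + 1 := by
      rw [sum_range_succ', sum_range_succ, qbinom_eq_zero_of_lt q (Nat.lt_succ_self m)]
      simp only [mul_zero, zero_mul, add_zero, qbinom_zero_right, pow_zero, mul_one,
        Nat.choose_zero_succ]
      congr 1
      refine sum_congr rfl fun j _ ↦ ?_
      ring
    have h2 : (-a) * (∑ j ∈ range (m + 1), q ^ (j + 1) * qbinom q m (j + 1) *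
          ((-a) ^ (j + 1) * q ^ (j + 1).choose 2) + 1) =
        ∑ j ∈ range (m + 1), qbinom q m j * ((-a) ^ (j + 1) * q ^ (j + 1).choose 2) := by
      rw [← h1, mul_sum]
      refine sum_congr rfl fun j _ ↦ ?_
      rw [Nat.choose_succ_succ' j 1, Nat.choose_one_right]
      ring
    rw [h1, mul_sub, mul_one, sub_eq_add_neg, ← mul_neg, mul_comm _ (-a), h2, add_right_comm,
      ← sum_add_distrib]
    congr 1
    · refine sum_congr rfl fun j _ ↦ ?_
      rw [qbinom_succ_succ]
      ring
    · simp

lemma thetaTerm_natCast (a b : S) (j : ℕ) :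
    thetaTerm a b j = (-a) ^ j * (a * b) ^ j.choose 2 := by
  have e1 := two_mul_triangle j
  have e2 := two_mul_triangle' j
  have e3 : 2 * ((j.choose 2 : ℕ) : ℤ) = j * (j - 1) := by
    rcases j with _ | j
    · simp
    · rw [Nat.choose_two_right, Nat.add_sub_cancel, mul_comm]
      have h := Nat.div_mul_cancel (Nat.even_mul_succ_self j).two_dvd
      zify at h
      push_cast
      rw [mul_comm ((j : ℤ) + 1) j, h]
      ring
  rw [thetaTerm]
  have hA : (j * (j + 1) / 2 : ℤ).toNat = j + j.choose 2 := by zify; linarith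
  have hB : (j * (j - 1) / 2 : ℤ).toNat = j.choose 2 := by zify; linarith
  rw [hA, hB, neg_pow a, Int.negOnePow_def, mul_pow, pow_add]
  simp
  ring

/-- Finite form of the Jacobi triple product identity. -/
lemma prod_mul_prod_eq_sum_qbinom (a b : S) (m n : ℕ) :
    (∏ k ∈ range m, (1 - a * (a * b) ^ k)) * ∏ k ∈ range n, (1 - b * (a * b) ^ k) =
      ∑ j ∈ range (m + n + 1), qbinom (a * b) (m + n) j * thetaTerm a b (j - n) := by
  induction n with
  | zero => simpa [thetaTerm_natCast] using prod_one_sub_eq_sum_qbinom a (a * b) m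
  | succ n ih =>
    rw [prod_range_succ, ← mul_assoc, ih, ← add_assoc, sum_range_succ' _ (m + n + 1),
      mul_sub, mul_one]
    have h : (∑ j ∈ range (m + n + 1), qbinom (a * b) (m + n) j * thetaTerm a b (j - n)) *
        (b * (a * b) ^ n) = -∑ j ∈ range (m + n + 1 + 1),
          (a * b) ^ j * qbinom (a * b) (m + n) j * thetaTerm a b (j - (n + 1)) := by
      rw [sum_range_succ _ (m + n + 1), qbinom_eq_zero_of_lt _ (by lia : m + n < m + n + 1),
        mul_zero, zero_mul, add_zero, sum_mul, ← sum_neg_distrib]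
      refine sum_congr rfl fun j _ ↦ ?_
      linear_combination qbinom (a * b) (m + n) j * mul_pow_mul_thetaTerm a b n j
    rw [h, sum_range_succ' _ (m + n + 1), sub_neg_eq_add, ← add_assoc, ← sum_add_distrib]
    congr 1
    · refine sum_congr rfl fun j _ ↦ ?_
      rw [qbinom_succ_succ]
      push_cast
      rw [show (j : ℤ) + 1 - (n + 1) = j - n by ring]
      ring
    · simp

lemma qbinom_mul_qfac {R : Type*} [CommRing R] (q : R⟦X⟧) (i j : ℕ) :
    qbinom q (i + j) j * qfac q j * qfac q i = qfac q (i + j) := by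
  induction h : i + j generalizing i j with
  | zero =>
    obtain ⟨rfl, rfl⟩ : i = 0 ∧ j = 0 := by lia
    simp [qfac]
  | succ n ih =>
    obtain _ | j := j
    · obtain rfl : i = n + 1 := by lia
      simp [qfac]
    · have h1 := ih i j (by lia)
      rw [qbinom_succ_succ, qfac_succ q j, qfac_succ q n]
      obtain _ | i := i
      · obtain rfl : n = j := by lia
        rw [qbinom_eq_zero_of_lt q (Nat.lt_succ_self n)]
        linear_combination (1 - q * q ^ n) * h1
      · have h2 := ih i (j + 1) (by lia)
        obtain rfl : n = i + 1 + j := by lia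
        rw [qfac_succ q j] at h2
        rw [qfac_succ q i] at h1 ⊢
        linear_combination (1 - q * q ^ j) * h1 + q ^ (j + 1) * (1 - q * q ^ i) * h2

end Algebra
end JacobiTripleProduct

section JacobiTripleProduct

variable {R : Type*} [CommRing R]

lemma X_pow_dvd_sum_sub_sum {ι : Type*} {f : ι → R⟦X⟧} {S T : Finset ι} {N : ℕ} (hST : S ⊆ T)
    (h : ∀ i ∈ T, i ∉ S → X ^ N ∣ f i) : X ^ N ∣ ∑ i ∈ S, f i - ∑ i ∈ T, f i := by
  classical
  rw [← sum_sdiff hST, sub_add_cancel_right]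
  refine (dvd_sum fun i hi ↦ ?_).neg_right
  rw [mem_sdiff] at hi
  exact h i hi.1 hi.2

lemma X_pow_dvd_thetaTerm {a b : R⟦X⟧} (hab : X ∣ a * b) {k : ℤ} {N : ℕ} (hk : N < |k|) :
    X ^ N ∣ thetaTerm a b k := by
  have e1 := two_mul_triangle k
  have e2 := two_mul_triangle' k
  have h0 : (N : ℤ) + 1 ≤ |k| := hk
  have hN : 2 * (N : ℤ) ≤ |k| * (|k| - 1) := by
    rcases Nat.eq_zero_or_pos N with rfl | hN
    · push_cast at h0 ⊢
      nlinarith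
    · have : (1 : ℤ) ≤ N := by exact_mod_cast hN
      nlinarith
  have hk1 : |k| * (|k| - 1) ≤ k * (k + 1) := by nlinarith [abs_mul_abs_self k, neg_abs_le k]
  have hk2 : |k| * (|k| - 1) ≤ k * (k - 1) := by nlinarith [abs_mul_abs_self k, le_abs_self k]
  obtain ⟨c, hc⟩ := Nat.exists_eq_add_of_le (show N ≤ (k * (k + 1) / 2).toNat by lia)
  obtain ⟨d, hd⟩ := Nat.exists_eq_add_of_le (show N ≤ (k * (k - 1) / 2).toNat by lia)
  rw [thetaTerm, hc, hd, pow_add, pow_add, mul_mul_mul_comm, ← mul_pow]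
  exact ((X_pow_dvd_pow hab N).mul_right _).mul_left _

variable [TopologicalSpace R]

lemma hasSum_of_X_pow_dvd {ι : Type*} {f : ι → R⟦X⟧} {s : R⟦X⟧}
    (h : ∀ N, ∃ S : Finset ι, ∀ T, S ⊆ T → X ^ N ∣ s - ∑ i ∈ T, f i) : HasSum f s := by
  rw [HasSum, SummationFilter.unconditional_filter, WithPiTopology.tendsto_iff_coeff_tendsto]
  intro d
  obtain ⟨S, hS⟩ := h (d + 1)
  refine tendsto_const_nhds.congr' (Filter.eventually_atTop.mpr ⟨S, fun T hT ↦ ?_⟩)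
  rw [← sub_eq_zero, ← map_sub]
  exact X_pow_dvd_iff.mp (hS T hT) d (by lia)

variable [T2Space R] [IsTopologicalRing R]

lemma X_pow_dvd_qprod_sub_qfac {q : R⟦X⟧} (hq : X ∣ q) {N n : ℕ} (h : N ≤ n) :
    X ^ N ∣ qprod q q - qfac q n :=
  (pow_dvd_pow _ h).trans (X_pow_dvd_qprod_sub_prod q hq n)

lemma X_pow_dvd_qbinom_mul_qprod_sub_one {q : R⟦X⟧} (hq : X ∣ q) {N i j : ℕ} (hi : N ≤ i)
    (hj : N ≤ j) : X ^ N ∣ qbinom q (i + j) j * qprod q q - 1 := by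
  rw [← (isUnit_qprod hq hq).dvd_mul_right]
  have h1 := X_pow_dvd_qprod_sub_qfac hq hi
  have h2 := X_pow_dvd_qprod_sub_qfac hq hj
  have h3 := X_pow_dvd_qprod_sub_qfac hq (show N ≤ i + j by lia)
  have h4 := qbinom_mul_qfac q i j
  convert (((h1.mul_left (qbinom q (i + j) j * qprod q q)).add
    (h2.mul_left (qbinom q (i + j) j * qfac q i))).sub h3) using 1
  linear_combination h4

/-- The Jacobi triple product identity for formal power series. -/
theorem hasSum_thetaTerm {a b : R⟦X⟧} (hab : X ∣ a * b) :
    HasSum (thetaTerm a b) (qprod a (a * b) * qprod b (a * b) * qprod (a * b) (a * b)) := by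
  refine hasSum_of_X_pow_dvd fun N ↦ ?_
  obtain ⟨M, hM⟩ : ∃ M, M = 2 * N + 1 := ⟨_, rfl⟩
  have hinj : Function.Injective fun j : ℕ ↦ (j - M : ℤ) := fun i j h ↦ by simpa using h
  refine ⟨(range (M + M + 1)).map ⟨_, hinj⟩, fun T hT ↦ ?_⟩
  have h1 : X ^ N ∣ qprod a (a * b) * qprod b (a * b) * qprod (a * b) (a * b) -
      (∏ k ∈ range M, (1 - a * (a * b) ^ k)) * (∏ k ∈ range M, (1 - b * (a * b) ^ k)) *
        qprod (a * b) (a * b) := by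
    have ha := (pow_dvd_pow X (by lia : N ≤ M)).trans (X_pow_dvd_qprod_sub_prod a hab M)
    have hb := (pow_dvd_pow X (by lia : N ≤ M)).trans (X_pow_dvd_qprod_sub_prod b hab M)
    convert ((ha.mul_right (qprod b (a * b))).add
      (hb.mul_left (∏ k ∈ range M, (1 - a * (a * b) ^ k)))).mul_right (qprod (a * b) (a * b))
      using 1
    ring
  have h2 : X ^ N ∣ (∏ k ∈ range M, (1 - a * (a * b) ^ k)) *
      (∏ k ∈ range M, (1 - b * (a * b) ^ k)) * qprod (a * b) (a * b) -
        ∑ j ∈ range (M + M + 1), thetaTerm a b (j - M) := by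
    rw [prod_mul_prod_eq_sum_qbinom, sum_mul, ← sum_sub_distrib]
    refine dvd_sum fun j hj ↦ ?_
    rw [mem_range] at hj
    rw [mul_right_comm, ← sub_one_mul]
    by_cases hjN : (N : ℤ) < |(j - M : ℤ)|
    · exact (X_pow_dvd_thetaTerm hab hjN).mul_left _
    · rw [not_lt, abs_le] at hjN
      have := X_pow_dvd_qbinom_mul_qprod_sub_one hab (show N ≤ M + M - j by lia)
        (show N ≤ j by lia)
      rw [Nat.sub_add_cancel (by lia)] at this
      exact this.mul_right _
  have h3 : X ^ N ∣ ∑ j ∈ range (M + M + 1), thetaTerm a b (j - M) - ∑ k ∈ T, thetaTerm a b k := by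
    have := X_pow_dvd_sum_sub_sum (N := N) (f := thetaTerm a b) hT fun k _ hk ↦
      X_pow_dvd_thetaTerm hab ?_
    · rwa [sum_map] at this
    · by_contra! hkN
      rw [abs_le] at hkN
      exact hk (mem_map.mpr ⟨(k + M).toNat, mem_range.mpr (by lia), by
        simp only [Function.Embedding.coeFn_mk]; lia⟩)
  simpa using (h1.add h2).add h3

end JacobiTripleProduct

section QBinomialTheorem

variable {R : Type*} [CommRing R]

/-- The sum `∑ f m` of a sequence of power series such that `X ^ m ∣ f m`. -/
noncomputable def gradedSum (f : ℕ → R⟦X⟧) : R⟦X⟧ :=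
  PowerSeries.mk fun d ↦ ∑ m ∈ range (d + 1), coeff d (f m)

lemma coeff_gradedSum (f : ℕ → R⟦X⟧) (d : ℕ) :
    coeff d (gradedSum f) = ∑ m ∈ range (d + 1), coeff d (f m) := coeff_mk _ _

lemma X_pow_dvd_gradedSum_sub {f : ℕ → R⟦X⟧} (hf : ∀ m, X ^ m ∣ f m) (N : ℕ) :
    X ^ N ∣ gradedSum f - ∑ m ∈ range N, f m := by
  refine X_pow_dvd_iff.mpr fun d hd ↦ ?_
  rw [map_sub, map_sum, coeff_gradedSum, sub_eq_zero]
  refine sum_subset (range_subset_range.mpr hd) fun m _ hm ↦ ?_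
  exact X_pow_dvd_iff.mp (hf m) d (by simpa using hm)

lemma mul_gradedSum {f : ℕ → R⟦X⟧} (hf : ∀ m, X ^ m ∣ f m) (p : R⟦X⟧) :
    p * gradedSum f = gradedSum fun m ↦ p * f m := by
  refine eq_of_forall_X_pow_dvd_sub fun N ↦ ?_
  have h1 := (X_pow_dvd_gradedSum_sub hf N).mul_left p
  have h2 := X_pow_dvd_gradedSum_sub (fun m ↦ (hf m).mul_left p) N
  rw [mul_sub, mul_sum] at h1
  simpa using h1.sub h2

lemma one_sub_mul_gradedSum {b : R⟦X⟧} {h : ℕ → R⟦X⟧}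
    (hh : ∀ m, h m * qfac X m = ∏ k ∈ range m, (1 - b * X ^ k)) {y : R⟦X⟧} (hy : X ∣ y) :
    (1 - y) * gradedSum (fun m ↦ y ^ m * h m) =
      (1 - b * y) * gradedSum fun m ↦ (X * y) ^ m * h m := by
  have hrec : ∀ m, h (m + 1) * (1 - X ^ (m + 1)) = h m * (1 - b * X ^ m) := by
    intro m
    have h1 := hh (m + 1)
    rw [prod_range_succ, ← hh, qfac_succ, ← pow_succ'] at h1
    refine (isUnit_qfac (dvd_refl X) m).mul_right_cancel ?_
    linear_combination h1
  have key : ∀ M, ∑ m ∈ range (M + 1), y ^ m * h m - ∑ m ∈ range (M + 1), (X * y) ^ m * h m =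
      y * (∑ m ∈ range M, y ^ m * h m - b * ∑ m ∈ range M, (X * y) ^ m * h m) := by
    intro M
    induction M with
    | zero => simp
    | succ M ih =>
      rw [sum_range_succ, sum_range_succ _ (M + 1), sum_range_succ _ M,
        sum_range_succ (fun m ↦ (X * y) ^ m * h m) M]
      rw [sum_range_succ, sum_range_succ _ M] at ih
      linear_combination ih + y ^ (M + 1) * hrec M
  refine eq_of_forall_X_pow_dvd_sub fun N ↦ ?_
  have h1 := X_pow_dvd_gradedSum_sub (fun m ↦ (X_pow_dvd_pow hy m).mul_right (h m))
  have h2 := X_pow_dvd_gradedSum_sub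
    (fun m ↦ (X_pow_dvd_pow (hy.mul_left X) m).mul_right (h m))
  convert ((pow_dvd_pow X N.le_succ).trans ((h1 (N + 1)).sub (h2 (N + 1)))).sub
    (((h1 N).sub ((h2 N).mul_left b)).mul_left y) using 1
  linear_combination key N

variable [TopologicalSpace R] [T2Space R] [IsTopologicalRing R]

/-- The `q`-binomial theorem. -/
theorem gradedSum_mul_qprod {b : R⟦X⟧} {h : ℕ → R⟦X⟧}
    (hh : ∀ m, h m * qfac X m = ∏ k ∈ range m, (1 - b * X ^ k)) {y : R⟦X⟧} (hy : X ∣ y) :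
    gradedSum (fun m ↦ y ^ m * h m) * qprod y X = qprod (b * y) X := by
  have h0 : h 0 = 1 := by simpa [qfac] using hh 0
  have key : ∀ N, gradedSum (fun m ↦ y ^ m * h m) * ∏ k ∈ range N, (1 - y * X ^ k) =
      (∏ k ∈ range N, (1 - b * y * X ^ k)) * gradedSum fun m ↦ (y * X ^ N) ^ m * h m := by
    intro N
    induction N with
    | zero => simp
    | succ N ih =>
      have := one_sub_mul_gradedSum hh (hy.mul_right (X ^ N))
      rw [show X * (y * X ^ N) = y * X ^ (N + 1) by ring] at this
      rw [prod_range_succ, prod_range_succ]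
      linear_combination (1 - y * X ^ N) * ih + (∏ k ∈ range N, (1 - b * y * X ^ k)) * this
  refine eq_of_forall_X_pow_dvd_sub fun N ↦ ?_
  have h1 := (X_pow_dvd_qprod_sub_prod y (dvd_refl X) N).mul_left
    (gradedSum fun m ↦ y ^ m * h m)
  have h2 := X_pow_dvd_qprod_sub_prod (b * y) (dvd_refl X) N
  have h3 : X ^ N ∣ gradedSum (fun m ↦ (y * X ^ N) ^ m * h m) - 1 := by
    have hyN : X ^ (N + 1) ∣ y * X ^ N := by
      rw [pow_succ']
      exact mul_dvd_mul_right hy _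
    refine X_pow_dvd_iff.mpr fun d hd ↦ ?_
    rw [map_sub, sub_eq_zero, coeff_gradedSum, sum_range_succ', sum_eq_zero, zero_add]
    · simp [h0]
    · intro m _
      refine (X_pow_dvd_iff (n := N + 1)).mp ?_ d (by lia)
      exact (hyN.trans (dvd_pow_self _ m.succ_ne_zero)).mul_right _
  convert (h1.add (h3.mul_left (∏ k ∈ range N, (1 - b * y * X ^ k)))).sub h2 using 1
  linear_combination key N

end QBinomialTheorem

section CrankGeneratingFunction

variable {R : Type*} [CommRing R]

/-- The generating function of partitions with exactly `m` ones, where `z` marks the number of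
parts larger than `m`. -/
noncomputable def onesGenFun (z : R) (m : ℕ) : R⟦X⟧ :=
  PowerSeries.mk fun n ↦ ∑ π : n.Partition, if omegaOnes π = m then z ^ muParts π else 0

lemma omegaOnes_le {n : ℕ} (π : n.Partition) : omegaOnes π ≤ n := by
  calc omegaOnes π ≤ Multiset.card π.parts := Multiset.count_le_card _ _
    _ ≤ π.parts.sum := by
      simpa using Multiset.card_nsmul_le_sum (a := 1) fun x hx ↦ π.parts_pos hx
    _ = n := π.parts_sum

lemma X_pow_dvd_onesGenFun (z : R) (m : ℕ) : X ^ m ∣ onesGenFun z m := by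
  refine X_pow_dvd_iff.mpr fun d hd ↦ ?_
  rw [onesGenFun, coeff_mk]
  refine sum_eq_zero fun π _ ↦ if_neg ?_
  have := omegaOnes_le π
  lia

/-- The generating function of the number of ones, with `z` marking `muParts` and
`w` marking `omegaOnes`. -/
noncomputable def crankGenFun (z w : R) : R⟦X⟧ :=
  PowerSeries.mk fun n ↦
    ∑ π : n.Partition, (omegaOnes π : R) * (z ^ muParts π * w ^ omegaOnes π)

lemma crankGenFun_eq_gradedSum (z w : R) :
    crankGenFun z w = gradedSum fun m ↦ C ((m : R) * w ^ m) * onesGenFun z m := by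
  ext n
  simp only [crankGenFun, coeff_mk, coeff_gradedSum, coeff_C_mul, onesGenFun]
  simp_rw [mul_sum]
  rw [sum_comm]
  refine sum_congr rfl fun π _ ↦ ?_
  rw [sum_eq_single_of_mem (omegaOnes π) (mem_range.mpr (by have := omegaOnes_le π; lia))]
  · rw [if_pos rfl]
    ring
  · intro m _ hm
    rw [if_neg hm.symm, mul_zero]

/-- The weight of a part of size `i` which occurs `j` times. -/
def partWeight (z : R) (m : ℕ) (a : ℕ → R) (i j : ℕ) : R :=
  if i = 1 then a j else (if m < i then z else 1) ^ j

lemma prod_partWeight {n : ℕ} (z : R) {m : ℕ} (hm : 1 ≤ m) (a : ℕ → R) (π : n.Partition) :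
    π.parts.toFinsupp.prod (partWeight z m a) =
      (if omegaOnes π = 0 then 1 else a (omegaOnes π)) *
        z ^ Multiset.card (π.parts.filter fun x ↦ m < x) := by
  have h : Multiset.card (π.parts.filter fun x ↦ m < x) =
      ∑ i ∈ π.parts.toFinset.erase 1, if m < i then π.parts.count i else 0 := by
    rw [← Multiset.countP_eq_card_filter, ← sum_filter]
    have h1 := Multiset.toFinset_sum_count_eq (π.parts.filter fun x ↦ m < x)
    rw [← Multiset.countP_eq_card_filter, Multiset.toFinset_filter] at h1
    rw [← h1]
    refine sum_congr ?_ fun i hi ↦ ?_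
    · ext i
      simp only [mem_filter, mem_erase, Multiset.mem_toFinset]
      constructor
      · rintro ⟨h1, h2⟩
        exact ⟨⟨by lia, h1⟩, h2⟩
      · rintro ⟨⟨_, h1⟩, h2⟩
        exact ⟨h1, h2⟩
    · rw [Multiset.count_filter_of_pos (mem_filter.mp hi).2]
  rw [h, ← prod_pow_eq_pow_sum, Finsupp.prod, Multiset.toFinsupp_support]
  have h2 : ∏ i ∈ π.parts.toFinset.erase 1, partWeight z m a i (π.parts.toFinsupp i) =
      ∏ i ∈ π.parts.toFinset.erase 1, z ^ (if m < i then π.parts.count i else 0) := by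
    refine prod_congr rfl fun i hi ↦ ?_
    rw [partWeight, if_neg (mem_erase.mp hi).1, Multiset.toFinsupp_apply]
    split_ifs <;> simp
  split_ifs with h0
  · rw [one_mul, ← h2, erase_eq_of_notMem]
    rwa [Multiset.mem_toFinset, ← Multiset.count_eq_zero]
  · rw [← h2, ← mul_prod_erase π.parts.toFinset _ (a := 1)]
    · rw [partWeight, if_pos rfl, Multiset.toFinsupp_apply, omegaOnes]
    · rwa [Multiset.mem_toFinset, ← Multiset.count_ne_zero]

lemma onesGenFun_eq_genFun_sub (z : R) {m : ℕ} (hm : 1 ≤ m) :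
    onesGenFun z m = Nat.Partition.genFun (partWeight z m fun j ↦ if j = m then 1 else 0) -
      Nat.Partition.genFun (partWeight z m 0) := by
  ext n
  rw [map_sub, Nat.Partition.coeff_genFun, Nat.Partition.coeff_genFun, onesGenFun, coeff_mk,
    ← sum_sub_distrib]
  refine sum_congr rfl fun π _ ↦ ?_
  rw [prod_partWeight z hm, prod_partWeight z hm, ← sub_mul]
  by_cases h : omegaOnes π = m
  · simp [h, muParts, show m ≠ 0 by lia]
  · by_cases h0 : omegaOnes π = 0 <;> simp [h, h0]
    lia

/-- The coefficients `(zq; q)_m / (q; q)_m`. -/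
noncomputable def qbinomCoeff (z : R) (m : ℕ) : R⟦X⟧ :=
  (∏ k ∈ range m, (1 - C z * X * X ^ k)) * Ring.inverse (qfac X m)

lemma qbinomCoeff_mul_qfac (z : R) (m : ℕ) :
    qbinomCoeff z m * qfac X m = ∏ k ∈ range m, (1 - C z * X * X ^ k) := by
  rw [qbinomCoeff, mul_assoc, Ring.inverse_mul_cancel _ (isUnit_qfac (dvd_refl X) m), mul_one]

variable [TopologicalSpace R] [T2Space R] [IsTopologicalRing R]

lemma one_add_tsum_geometric_mul (c : R) (i : ℕ) :
    (1 + ∑' j : ℕ, c ^ (j + 1) • (X : R⟦X⟧) ^ ((i + 1) * (j + 1))) * (1 - C c * X ^ (i + 1)) = 1 := by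
  have h0 : constantCoeff (C c * (X : R⟦X⟧) ^ (i + 1)) = 0 := by simp
  have h1 : ∀ j : ℕ, c ^ (j + 1) • (X : R⟦X⟧) ^ ((i + 1) * (j + 1)) =
      (C c * X ^ (i + 1)) ^ (j + 1) := by
    intro j
    rw [smul_eq_C_mul, mul_pow, ← pow_mul, map_pow]
  generalize C c * (X : R⟦X⟧) ^ (i + 1) = y at h0 h1 ⊢
  simp_rw [h1]
  have h2 : Summable fun j ↦ y ^ (j + 1) := by
    simp_rw [pow_succ']
    exact (WithPiTopology.summable_pow_of_constantCoeff_eq_zero h0).mul_left y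
  have h3 := tsum_eq_zero_add' h2
  rw [pow_zero] at h3
  rw [← h3]
  exact WithPiTopology.tsum_pow_mul_one_sub_of_constantCoeff_eq_zero h0

lemma genFun_mul_tprod (c : ℕ → R) (hc : c 0 = 0) (f : ℕ → ℕ → R)
    (hf : ∀ i j, f (i + 2) (j + 1) = c (i + 1) ^ (j + 1)) :
    Nat.Partition.genFun f * ∏' i, (1 - C (c i) * X ^ (i + 1)) =
      1 + ∑' j, f 1 (j + 1) • X ^ (j + 1) := by
  have hm : Multipliable fun i ↦ 1 - C (c i) * X ^ (i + 1) :=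
    multipliable_one_sub_of_X_pow_dvd fun i ↦ (pow_dvd_pow X i.le_succ).mul_left _
  rw [Nat.Partition.genFun_eq_tprod, ← (Nat.Partition.multipliable_genFun f).tprod_mul hm,
    tprod_eq_mulSingle 0]
  · simp [hc]
  · intro i hi
    obtain ⟨i, rfl⟩ := Nat.exists_eq_add_one_of_ne_zero hi
    simp_rw [add_assoc, one_add_one_eq_two, hf]
    exact one_add_tsum_geometric_mul _ _

lemma onesGenFun_mul_tprod (z : R) {m : ℕ} (hm : 1 ≤ m) :
    onesGenFun z m * ∏' i : ℕ, (1 - C (if i = 0 then 0 else if m ≤ i then z else 1) * X ^ (i + 1)) =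
      X ^ m := by
  have h := genFun_mul_tprod (fun i ↦ if i = 0 then 0 else if m ≤ i then z else 1) (if_pos rfl)
  rw [onesGenFun_eq_genFun_sub z hm, sub_mul, h, h, tsum_eq_single (m - 1), Nat.sub_add_cancel hm]
  · simp [partWeight]
  · intro j hj
    rw [partWeight, if_pos rfl, if_neg (by lia), zero_smul]
  all_goals
    intro i j
    simp [partWeight, Nat.lt_iff_add_one_le]

lemma onesGenFun_mul_qprod (z : R) {m : ℕ} (hm : 1 ≤ m) :
    onesGenFun z m * qprod (C z * X) X * qfac X m =
      (1 - X) * X ^ m * ∏ k ∈ range m, (1 - C z * X * X ^ k) := by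
  have h1 := onesGenFun_mul_tprod z hm
  rw [tprod_one_sub_eq (fun i ↦ (pow_dvd_pow X i.le_succ).mul_left _) m] at h1
  have h2 : ∏' k, (1 - C (if k + m = 0 then 0 else if m ≤ k + m then z else 1) *
      (X : R⟦X⟧) ^ (k + m + 1)) = qprod (C z * X * X ^ m) X := by
    refine tprod_congr fun k ↦ ?_
    rw [if_neg (by lia), if_pos (by lia)]
    ring
  have h3 : (1 - X) * ∏ k ∈ range m, (1 - C (if k = 0 then 0 else if m ≤ k then z else 1) *
      (X : R⟦X⟧) ^ (k + 1)) = qfac X m := by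
    obtain ⟨m, rfl⟩ := Nat.exists_eq_add_of_le' hm
    rw [qfac, prod_range_succ', prod_range_succ']
    simp only [if_true, map_zero, zero_mul, sub_zero, mul_one, pow_zero]
    rw [mul_comm]
    congr 1
    refine prod_congr rfl fun k hk ↦ ?_
    rw [if_neg (by lia), if_neg (by rw [mem_range] at hk; lia)]
    simp [pow_succ']
  rw [h2] at h1
  rw [qprod_eq_prod_mul (C z * X) (dvd_refl X) m, ← h3]
  linear_combination (1 - X) * (∏ k ∈ range m, (1 - C z * X * X ^ k)) * h1

lemma qprod_mul_crankGenFun (z w : R) :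
    qprod (C z * X) X * crankGenFun z w =
      (1 - X) * gradedSum fun m ↦ C ((m : R) * w ^ m) * (X ^ m * qbinomCoeff z m) := by
  rw [crankGenFun_eq_gradedSum, mul_gradedSum fun m ↦ (X_pow_dvd_onesGenFun z m).mul_left _,
    mul_gradedSum fun m ↦ (Dvd.intro _ rfl).mul_left _]
  congr 1
  ext1 m
  rcases Nat.eq_zero_or_pos m with rfl | hm
  · simp
  · refine (isUnit_qfac (dvd_refl X) m).mul_right_cancel ?_
    linear_combination C ((m : R) * w ^ m) * (onesGenFun_mul_qprod z hm -
      (1 - X) * X ^ m * qbinomCoeff_mul_qfac z m)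

end CrankGeneratingFunction

section DualNumbers

lemma map_qprod {R S : Type*} [CommRing R] [TopologicalSpace R] [T2Space R] [IsTopologicalRing R]
    [CommRing S] [TopologicalSpace S] [T2Space S] [IsTopologicalRing S] (φ : R →+* S) (a : R⟦X⟧)
    {q : R⟦X⟧} (hq : X ∣ q) : map φ (qprod a q) = qprod (map φ a) (map φ q) := by
  have hq' : X ∣ map φ q := by simpa using map_dvd (map φ) hq
  refine eq_of_forall_X_pow_dvd_sub fun N ↦ ?_
  have h1 := map_dvd (map φ) (X_pow_dvd_qprod_sub_prod a hq N)
  have h2 := X_pow_dvd_qprod_sub_prod (map φ a) hq' N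
  simp only [map_pow, map_X, map_sub, map_prod, map_mul, map_one] at h1
  simpa using h1.sub h2

lemma qprod_mul_qprod_congr {R : Type*} [CommRing R] [TopologicalSpace R] [T2Space R]
    [IsTopologicalRing R] {a b c d q : R⟦X⟧} (hq : X ∣ q) (h1 : a + b = c + d)
    (h2 : a * b = c * d) : qprod a q * qprod b q = qprod c q * qprod d q := by
  simp only [qprod]
  rw [← (multipliable_qprod a hq).tprod_mul (multipliable_qprod b hq),
    ← (multipliable_qprod c hq).tprod_mul (multipliable_qprod d hq)]
  refine tprod_congr fun k ↦ ?_
  linear_combination (-q ^ k) * h1 + q ^ k * q ^ k * h2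

open TrivSqZeroExt DualNumber

/-- The part of a power series over the dual numbers not involving `ε`. -/
noncomputable def fstSeries : ℂ[ε]⟦X⟧ →+* ℂ⟦X⟧ := map (fstHom ℂ ℂ ℂ).toRingHom

/-- The coefficient of `ε` in a power series over the dual numbers. -/
noncomputable def sndSeries (f : ℂ[ε]⟦X⟧) : ℂ⟦X⟧ := PowerSeries.mk fun n ↦ (coeff n f).snd

/-- The embedding of power series over `ℂ` in power series over the dual numbers. -/
noncomputable def inlSeries : ℂ⟦X⟧ →+* ℂ[ε]⟦X⟧ := map (inlHom ℂ ℂ)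

lemma coeff_fstSeries (f : ℂ[ε]⟦X⟧) (n : ℕ) : coeff n (fstSeries f) = (coeff n f).fst := by
  simp [fstSeries]

lemma coeff_sndSeries (f : ℂ[ε]⟦X⟧) (n : ℕ) : coeff n (sndSeries f) = (coeff n f).snd :=
  coeff_mk _ _

lemma coeff_inlSeries (f : ℂ⟦X⟧) (n : ℕ) : coeff n (inlSeries f) = inl (coeff n f) := by
  simp [inlSeries]

lemma sndSeries_mul (f g : ℂ[ε]⟦X⟧) :
    sndSeries (f * g) = fstSeries f * sndSeries g + sndSeries f * fstSeries g := by
  ext n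
  simp only [coeff_sndSeries, coeff_mul, map_add, coeff_fstSeries, snd_sum, ← sum_add_distrib,
    DualNumber.snd_mul]

@[simp] lemma fstSeries_inlSeries (f : ℂ⟦X⟧) : fstSeries (inlSeries f) = f := by
  ext n
  simp [coeff_fstSeries, coeff_inlSeries]

@[simp] lemma sndSeries_inlSeries (f : ℂ⟦X⟧) : sndSeries (inlSeries f) = 0 := by
  ext n
  simp [coeff_sndSeries, coeff_inlSeries]

@[simp] lemma fstSeries_C (a : ℂ[ε]) : fstSeries (C a) = C a.fst := by
  simp [fstSeries]

@[simp] lemma sndSeries_C (a : ℂ[ε]) : sndSeries (C a) = C a.snd := by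
  ext n
  rw [coeff_sndSeries, coeff_C, coeff_C]
  split_ifs <;> simp

@[simp] lemma fstSeries_X : fstSeries X = X := map_X _

@[simp] lemma inlSeries_X : inlSeries X = X := map_X _

@[simp] lemma inlSeries_C (a : ℂ) : inlSeries (C a) = C (inl a) := map_C _ _

lemma sndSeries_sub (f g : ℂ[ε]⟦X⟧) : sndSeries (f - g) = sndSeries f - sndSeries g := by
  ext n
  simp [coeff_sndSeries]

lemma fstSeries_gradedSum (f : ℕ → ℂ[ε]⟦X⟧) :
    fstSeries (gradedSum f) = gradedSum fun m ↦ fstSeries (f m) := by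
  ext n
  simp [coeff_fstSeries, coeff_gradedSum, fst_sum]

lemma sndSeries_gradedSum (f : ℕ → ℂ[ε]⟦X⟧) :
    sndSeries (gradedSum f) = gradedSum fun m ↦ sndSeries (f m) := by
  ext n
  simp [coeff_sndSeries, coeff_gradedSum, snd_sum]

lemma hasSum_sndSeries {ι : Type*} {f : ι → ℂ[ε]⟦X⟧} {s : ℂ[ε]⟦X⟧} (h : HasSum f s) :
    HasSum (fun i ↦ sndSeries (f i)) (sndSeries s) := by
  rw [HasSum, SummationFilter.unconditional_filter, WithPiTopology.tendsto_iff_coeff_tendsto] at h ⊢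
  intro d
  have := (TrivSqZeroExt.continuous_snd.tendsto _).comp (h d)
  simpa [Function.comp_def, coeff_sndSeries, snd_sum] using this

lemma hasSum_fstSeries {ι : Type*} {f : ι → ℂ[ε]⟦X⟧} {s : ℂ[ε]⟦X⟧} (h : HasSum f s) :
    HasSum (fun i ↦ fstSeries (f i)) (fstSeries s) := by
  rw [HasSum, SummationFilter.unconditional_filter, WithPiTopology.tendsto_iff_coeff_tendsto] at h ⊢
  intro d
  have := (TrivSqZeroExt.continuous_fst.tendsto _).comp (h d)
  simpa [Function.comp_def, coeff_fstSeries, fst_sum] using this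

/-- The product `(zq; q)_∞` as a formal power series in `q`. -/
noncomputable def eulerProd (z : ℂ) : ℂ⟦X⟧ := qprod (C z * X) X

/-- The derivative `z ∂/∂z` of `(zq; q)_∞`. -/
noncomputable def eulerProdDeriv (z : ℂ) : ℂ⟦X⟧ :=
  sndSeries (qprod (C (inl z * (1 + ε)) * X) X)

lemma isUnit_eulerProd (z : ℂ) : IsUnit (eulerProd z) :=
  isUnit_qprod (dvd_refl X) (Dvd.intro_left _ rfl)

lemma fstSeries_qprod (a : ℂ[ε]⟦X⟧) : fstSeries (qprod a X) = qprod (fstSeries a) X := by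
  rw [fstSeries, map_qprod _ a (dvd_refl X), map_X]

lemma inlSeries_qprod (a : ℂ⟦X⟧) : inlSeries (qprod a X) = qprod (inlSeries a) X := by
  rw [inlSeries, map_qprod _ a (dvd_refl X), map_X]

lemma sndSeries_qprod_inv (z : ℂ) :
    sndSeries (qprod (C (inl z * (1 - ε)) * X) X) = -eulerProdDeriv z := by
  have hε : (ε * ε : ℂ[ε]) = 0 := eps_mul_eps
  have h : qprod (C (inl z * (1 + ε)) * X) X * qprod (C (inl z * (1 - ε)) * X) X =
      inlSeries (eulerProd z * eulerProd z) := by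
    rw [map_mul inlSeries, eulerProd, inlSeries_qprod, qprod_mul_qprod_congr (dvd_refl X)]
    · have : (inl z * (1 + ε) + inl z * (1 - ε) : ℂ[ε]) = inl z + inl z := by ring
      have h2 := congrArg (C (R := ℂ[ε])) this
      simp only [map_add, map_sub, map_mul, inlSeries_C, inlSeries_X] at h2 ⊢
      linear_combination X * h2
    · have : (inl z * (1 + ε) * (inl z * (1 - ε)) : ℂ[ε]) = inl z * inl z := by
        linear_combination (-inl z * inl z) * hε
      have h2 := congrArg (C (R := ℂ[ε])) this
      simp only [map_mul, inlSeries_C, inlSeries_X] at h2 ⊢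
      linear_combination X * X * h2
  have h2 := congrArg sndSeries h
  rw [sndSeries_inlSeries, sndSeries_mul, fstSeries_qprod, fstSeries_qprod] at h2
  simp only [map_mul fstSeries, fstSeries_C, fstSeries_X, TrivSqZeroExt.fst_mul, fst_inl, fst_add,
    fst_sub, fst_one, fst_eps, add_zero, sub_zero, mul_one] at h2
  rw [← eulerProd, ← eulerProdDeriv, mul_comm (eulerProdDeriv z), ← mul_add] at h2
  exact eq_neg_of_add_eq_zero_left ((isUnit_eulerProd z).mul_right_eq_zero.mp h2)

end DualNumbers

section CrankAndTheta

open TrivSqZeroExt DualNumber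

lemma one_add_eps_mul_inl_pow (w : ℂ) (m : ℕ) :
    (inl w * (1 + ε) : ℂ[ε]) ^ m = inl (w ^ m) + inr (m * w ^ m) := by
  ext
  · simp
  · rw [TrivSqZeroExt.snd_pow]
    rcases m with _ | m
    · simp
    · simp [pow_succ]

lemma one_sub_eps_mul_inl_pow (w : ℂ) (m : ℕ) :
    (inl w * (1 - ε) : ℂ[ε]) ^ m = inl (w ^ m) - inr (m * w ^ m) := by
  ext
  · simp
  · rw [TrivSqZeroExt.snd_pow]
    rcases m with _ | m
    · simp
    · simp [pow_succ]

/-- The series `∑ m wᵐ qᵐ (zq; q)_m / (q; q)_m`. -/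
noncomputable def weightedQBinomSum (z w : ℂ) : ℂ⟦X⟧ :=
  gradedSum fun m ↦ C ((m : ℂ) * w ^ m) * (X ^ m * qbinomCoeff z m)

lemma weightedQBinomSum_identity {z w : ℂ} (hzw : z * w = 1) :
    eulerProdDeriv w * eulerProd 1 + (1 - X) * eulerProd w ^ 2 * weightedQBinomSum z w =
      (1 - X) * sndSeries (qprod (C (1 + ε) * X * X) X) * eulerProd w := by
  have hzw' : (inl z * inl w : ℂ[ε]) = 1 := by rw [← inl_mul, hzw, inl_one]
  have h := gradedSum_mul_qprod (b := inlSeries (C z * X))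
    (h := fun m ↦ inlSeries (qbinomCoeff z m)) (y := C (inl w * (1 + ε)) * X) ?_
    (Dvd.intro_left _ rfl)
  · have e1 : inlSeries (C z * X) * (C (inl w * (1 + ε)) * X) = C (1 + ε) * X * X := by
      have h2 := congrArg (C (R := ℂ[ε])) hzw'
      simp only [map_mul, map_one, inlSeries_C, inlSeries_X] at h2 ⊢
      linear_combination C (1 + ε) * X * X * h2
    rw [e1] at h
    have hy : ∀ m, (C (inl w * (1 + ε)) * X : ℂ[ε]⟦X⟧) ^ m * inlSeries (qbinomCoeff z m) =
        C (inl (w ^ m) + inr (m * w ^ m)) * inlSeries (X ^ m * qbinomCoeff z m) := by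
      intro m
      rw [mul_pow, ← map_pow, one_add_eps_mul_inl_pow, map_mul inlSeries, map_pow inlSeries,
        inlSeries_X, mul_assoc]
    simp_rw [hy] at h
    have h1 := congrArg sndSeries h
    have h2 := congrArg fstSeries h
    rw [sndSeries_mul, fstSeries_qprod, fstSeries_gradedSum, sndSeries_gradedSum,
      ← eulerProdDeriv] at h1
    rw [map_mul, fstSeries_qprod, fstSeries_qprod, fstSeries_gradedSum] at h2
    simp only [map_mul fstSeries, sndSeries_mul, fstSeries_C, sndSeries_C, fstSeries_X,
      fstSeries_inlSeries, sndSeries_inlSeries, fst_add, snd_add, fst_inl, fst_inr, snd_inl,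
      snd_inr, add_zero, zero_add, mul_zero, TrivSqZeroExt.fst_mul, fst_one, fst_eps, mul_one,
      map_one, one_mul] at h1 h2
    rw [← eulerProd, ← weightedQBinomSum] at h1
    rw [← eulerProd] at h2
    have h3 : eulerProd 1 = (1 - X) * qprod (X * X) X := by
      rw [eulerProd, map_one, one_mul, qprod_eq_one_sub_mul X (dvd_refl X)]
    rw [h3]
    linear_combination (1 - X) * eulerProd w * h1 - (1 - X) * eulerProdDeriv w * h2
  · intro m
    have h2 := congrArg inlSeries (qbinomCoeff_mul_qfac z m)
    simpa [qfac, map_prod] using h2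

lemma eulerProd_mul_crankGenFun (z w : ℂ) :
    eulerProd z * crankGenFun z w = (1 - X) * weightedQBinomSum z w := qprod_mul_crankGenFun z w

/-- The numerator of the logarithmic derivative of `(zq; q)_∞ / (wq; q)_∞`. -/
noncomputable def eulerWronskian (z w : ℂ) : ℂ⟦X⟧ :=
  eulerProdDeriv z * eulerProd w - eulerProd z * eulerProdDeriv w

lemma crankGenFun_sub_crankGenFun {z w : ℂ} (hzw : z * w = 1) :
    (crankGenFun z w - crankGenFun w z) * eulerProd z ^ 2 * eulerProd w ^ 2 =
      eulerProd 1 * eulerWronskian z w := by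
  have h1 := weightedQBinomSum_identity hzw
  have h2 := weightedQBinomSum_identity (mul_comm w z ▸ hzw)
  have h3 := eulerProd_mul_crankGenFun z w
  have h4 := eulerProd_mul_crankGenFun w z
  rw [eulerWronskian]
  linear_combination eulerProd z * h1 - eulerProd w * h2 + eulerProd z * eulerProd w ^ 2 * h3 -
    eulerProd w * eulerProd z ^ 2 * h4

/-- The `k`-th term `(-1)ᵏ zᵏ q^{k(k+1)/2}` of a partial theta series. -/
noncomputable def thetaSummand (z : ℂ) (k : ℤ) : ℂ⟦X⟧ :=
  C ((-1) ^ k * z ^ k) * X ^ (k * (k + 1) / 2).toNat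

lemma thetaTerm_dualNumber {z : ℂ} (hz : z ≠ 0) (k : ℤ) :
    thetaTerm (C (inl z * (1 + ε)) * X) (C (inl z⁻¹ * (1 - ε)) : ℂ[ε]⟦X⟧) k =
      C (1 + inr (k : ℂ)) * inlSeries (thetaSummand z k) := by
  have e1 := two_mul_triangle k
  have e2 := two_mul_triangle' k
  rw [thetaTerm, thetaSummand, map_mul inlSeries, map_pow inlSeries, inlSeries_X, inlSeries_C]
  set A := (k * (k + 1) / 2).toNat
  set B := (k * (k - 1) / 2).toNat
  have hk : k = A - B := by linarith
  have hs : ((k.negOnePow : ℤ) : ℂ[ε]⟦X⟧) = C (inl ((-1 : ℂ) ^ k)) := by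
    rw [← Int.cast_negOnePow, ← inlSeries_C, map_intCast, map_intCast]
  have hd : (inl z * (1 + ε) : ℂ[ε]) ^ A * (inl z⁻¹ * (1 - ε)) ^ B =
      (1 + inr (k : ℂ)) * inl (z ^ k) := by
    rw [one_add_eps_mul_inl_pow, one_sub_eps_mul_inl_pow]
    have hzk : z ^ k = z ^ A * z⁻¹ ^ B := by
      rw [hk, zpow_sub₀ hz, zpow_natCast, zpow_natCast, inv_pow, div_eq_mul_inv]
    have hk' : (k : ℂ) = A - B := by rw [hk]; push_cast; ring
    rw [hzk, hk']
    ext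
    · simp
    · simp
      ring
  have h := congrArg (C (R := ℂ[ε])) hd
  rw [hs, inl_mul]
  simp only [map_mul, map_pow, mul_pow] at h ⊢
  linear_combination C (inl ((-1 : ℂ) ^ k)) * X ^ A * h

lemma hasSum_thetaTerm_dualNumber {z : ℂ} (hz : z ≠ 0) :
    HasSum (fun k : ℤ ↦ C (1 + inr (k : ℂ)) * inlSeries (thetaSummand z k))
      (qprod (C (inl z * (1 + ε)) * X) X * ((1 - C (inl z⁻¹ * (1 - ε))) *
        qprod (C (inl z⁻¹ * (1 - ε)) * X) X) * inlSeries (eulerProd 1)) := by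
  have hab : (C (inl z * (1 + ε)) * X) * (C (inl z⁻¹ * (1 - ε)) : ℂ[ε]⟦X⟧) = X := by
    have hd : (inl z * (1 + ε)) * (inl z⁻¹ * (1 - ε)) = (1 : ℂ[ε]) := by
      have h1 : (inl z * inl z⁻¹ : ℂ[ε]) = 1 := by rw [← inl_mul, mul_inv_cancel₀ hz, inl_one]
      have hε : (ε * ε : ℂ[ε]) = 0 := eps_mul_eps
      linear_combination (1 - ε * ε) * h1 - hε
    rw [mul_right_comm, ← map_mul, hd, map_one, one_mul]
  have h := hasSum_thetaTerm (a := C (inl z * (1 + ε)) * X)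
    (b := (C (inl z⁻¹ * (1 - ε)) : ℂ[ε]⟦X⟧)) (by rw [hab])
  rw [hab, qprod_eq_one_sub_mul (C (inl z⁻¹ * (1 - ε))) (dvd_refl X)] at h
  rw [funext (thetaTerm_dualNumber hz)] at h
  rwa [eulerProd, inlSeries_qprod, map_one, one_mul, inlSeries_X]

/-- The two-variable Jacobi triple product. -/
lemma hasSum_thetaSummand {z : ℂ} (hz : z ≠ 0) :
    HasSum (thetaSummand z) ((1 - C z⁻¹) * eulerProd 1 * eulerProd z * eulerProd z⁻¹) := by
  have h := hasSum_fstSeries (hasSum_thetaTerm_dualNumber hz)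
  simp only [map_mul fstSeries, map_sub fstSeries, map_one fstSeries, fstSeries_C, fstSeries_X,
    fstSeries_inlSeries, fst_add, fst_sub, fst_one, fst_inr, add_zero, map_one, one_mul,
    fstSeries_qprod, TrivSqZeroExt.fst_mul, fst_inl, fst_eps, sub_zero, mul_one] at h
  convert h using 1
  rw [← eulerProd, ← eulerProd]
  ring

/-- The derivative of the Jacobi triple product. -/
lemma hasSum_mul_thetaSummand {z : ℂ} (hz : z ≠ 0) :
    HasSum (fun k : ℤ ↦ C (k : ℂ) * thetaSummand z k)
      ((1 - C z⁻¹) * eulerProd 1 * eulerWronskian z z⁻¹ +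
        C z⁻¹ * eulerProd 1 * eulerProd z * eulerProd z⁻¹) := by
  have h := hasSum_sndSeries (hasSum_thetaTerm_dualNumber hz)
  have h1 : sndSeries (1 : ℂ[ε]⟦X⟧) = 0 := by
    rw [← map_one inlSeries, sndSeries_inlSeries]
  simp only [sndSeries_mul, sndSeries_sub, map_mul fstSeries, map_sub fstSeries,
    map_one fstSeries, fstSeries_C, fstSeries_X, sndSeries_C, h1,
    fstSeries_inlSeries, sndSeries_inlSeries, fst_add, fst_sub, fst_one, fst_inr, add_zero,
    map_one, mul_zero, zero_add, sndSeries_qprod_inv,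
    fstSeries_qprod, TrivSqZeroExt.fst_mul, DualNumber.snd_mul, snd_one, snd_add, snd_sub, snd_inl,
    snd_eps, snd_inr, fst_inl, fst_eps, sub_zero, mul_one] at h
  rw [← eulerProdDeriv, ← eulerProd, ← eulerProd] at h
  convert h using 1
  simp only [eulerWronskian, zero_sub, mul_neg, map_neg, mul_one]
  ring

end CrankAndTheta

section Dilation

/-- The substitution `q ↦ q⁵`. -/
noncomputable def dilate : ℂ⟦X⟧ →ₐ[ℂ] ℂ⟦X⟧ := PowerSeries.expand 5 (by norm_num)

lemma dilate_X : dilate X = X ^ 5 := PowerSeries.expand_X _ _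

lemma dilate_C (a : ℂ) : dilate (C a) = C a := PowerSeries.expand_C _ _ a

lemma coeff_dilate_mul (f : ℂ⟦X⟧) (n : ℕ) : coeff (5 * n) (dilate f) = coeff n f :=
  PowerSeries.coeff_expand_mul _ _ f n

lemma coeff_dilate_of_not_dvd (f : ℂ⟦X⟧) {n : ℕ} (h : ¬ 5 ∣ n) : coeff n (dilate f) = 0 :=
  PowerSeries.coeff_expand_of_not_dvd _ _ f h

lemma X_pow_dvd_dilate {f : ℂ⟦X⟧} {N : ℕ} (h : X ^ N ∣ f) : X ^ N ∣ dilate f := by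
  have h1 := map_dvd dilate h
  rw [map_pow, dilate_X, ← pow_mul] at h1
  exact (pow_dvd_pow X (by lia)).trans h1

lemma dilate_qprod (a : ℂ⟦X⟧) {q : ℂ⟦X⟧} (hq : X ∣ q) :
    dilate (qprod a q) = qprod (dilate a) (dilate q) := by
  have hq' : X ∣ dilate q := by simpa using X_pow_dvd_dilate (N := 1) (by simpa using hq)
  refine eq_of_forall_X_pow_dvd_sub fun N ↦ ?_
  have h1 := X_pow_dvd_dilate (X_pow_dvd_qprod_sub_prod a hq N)
  have h2 := X_pow_dvd_qprod_sub_prod (dilate a) hq' N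
  simp only [map_sub, map_prod, map_mul, map_one, map_pow] at h1
  simpa using h1.sub h2

lemma hasSum_dilate {ι : Type*} {f : ι → ℂ⟦X⟧} {s : ℂ⟦X⟧} (h : HasSum f s) :
    HasSum (fun i ↦ dilate (f i)) (dilate s) := by
  rw [HasSum, SummationFilter.unconditional_filter, WithPiTopology.tendsto_iff_coeff_tendsto] at h ⊢
  intro d
  simp_rw [← map_sum]
  by_cases hd : 5 ∣ d
  · obtain ⟨d, rfl⟩ := hd
    simpa only [coeff_dilate_mul] using h d
  · simp only [coeff_dilate_of_not_dvd _ hd, tendsto_const_nhds]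

lemma qprod_eq_qprod_pow_five (a : ℂ⟦X⟧) {q : ℂ⟦X⟧} (hq : X ∣ q) :
    qprod a q = qprod a (q ^ 5) * qprod (a * q) (q ^ 5) * qprod (a * q ^ 2) (q ^ 5) *
      qprod (a * q ^ 3) (q ^ 5) * qprod (a * q ^ 4) (q ^ 5) := by
  have hq' : X ∣ q ^ 5 := dvd_pow hq (by norm_num)
  have h (b : ℂ⟦X⟧) := multipliable_qprod b hq'
  simp only [qprod]
  rw [← (h _).tprod_mul (h _), ← ((h _).mul (h _)).tprod_mul (h _),
    ← (((h _).mul (h _)).mul (h _)).tprod_mul (h _),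
    ← ((((h _).mul (h _)).mul (h _)).mul (h _)).tprod_mul (h _)]
  refine tendsto_nhds_unique ((multipliable_qprod a hq).hasProd.tendsto_prod_nat.comp
    (Filter.tendsto_atTop_mono (fun n ↦ (by lia : n ≤ n * 5)) Filter.tendsto_id)) ?_
  refine (((((h a).mul (h (a * q))).mul (h (a * q ^ 2))).mul
    (h (a * q ^ 3))).mul (h (a * q ^ 4))).hasProd.tendsto_prod_nat.congr fun n ↦ ?_
  rw [Function.comp_apply]
  induction n with
  | zero => simp
  | succ n ih =>
    rw [prod_range_succ, ih, Nat.succ_mul, prod_range_add _ (n * 5) 5]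
    simp only [prod_range_succ, prod_range_zero, pow_add, pow_mul, pow_zero, pow_one]
    ring

lemma prod_one_sub_root_mul {S : Type*} [CommRing S] {z : S}
    (h : 1 + z + z ^ 2 + z ^ 3 + z ^ 4 = 0) (y : S) :
    (1 - y) * (1 - z * y) * (1 - z ^ 2 * y) * (1 - z ^ 3 * y) * (1 - z ^ 4 * y) = 1 - y ^ 5 := by
  grind

lemma eulerProd_root_mul {z : ℂ} (h5 : z ^ 5 = 1) (hz : z ≠ 1) :
    eulerProd 1 * eulerProd z * eulerProd (z ^ 2) * eulerProd (z ^ 3) * eulerProd (z ^ 4) =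
      dilate (eulerProd 1) := by
  have h0 : 1 + z + z ^ 2 + z ^ 3 + z ^ 4 = 0 := by
    refine mul_left_cancel₀ (sub_ne_zero.mpr hz) ?_
    linear_combination h5
  have h (b : ℂ⟦X⟧) := multipliable_qprod b (dvd_refl X)
  rw [eulerProd, dilate_qprod _ (dvd_refl X)]
  simp only [eulerProd, qprod]
  rw [← (h _).tprod_mul (h _), ← ((h _).mul (h _)).tprod_mul (h _),
    ← (((h _).mul (h _)).mul (h _)).tprod_mul (h _),
    ← ((((h _).mul (h _)).mul (h _)).mul (h _)).tprod_mul (h _)]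
  refine tprod_congr fun k ↦ ?_
  have h2 := congrArg (C (R := ℂ)) h0
  simp only [map_add, map_pow, map_one, map_zero] at h2
  simp only [map_pow, map_one, one_mul, dilate_X, mul_assoc]
  rw [← pow_mul, mul_comm 5 k, pow_mul, ← mul_pow, ← prod_one_sub_root_mul h2]
  ring

lemma eulerProd_one : eulerProd 1 = qprod X X := by
  rw [eulerProd, map_one, one_mul]

end Dilation

section Sections

/-- The series whose `n`-th coefficient is the coefficient of `f` at `5 * n + r`. -/
noncomputable def sect (r : ℕ) : ℂ⟦X⟧ →ₗ[ℂ] ℂ⟦X⟧ where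
  toFun f := mk fun n ↦ coeff (5 * n + r) f
  map_add' f g := by ext; simp
  map_smul' c f := by ext; simp

lemma coeff_sect (r n : ℕ) (f : ℂ⟦X⟧) : coeff n (sect r f) = coeff (5 * n + r) f := by
  simp [sect]

lemma sect_C_mul (r : ℕ) (c : ℂ) (f : ℂ⟦X⟧) : sect r (C c * f) = C c * sect r f := by
  ext n
  simp [coeff_sect]

lemma sect_succ_X_mul (r : ℕ) (f : ℂ⟦X⟧) : sect (r + 1) (X * f) = sect r f := by
  ext n
  rw [coeff_sect, coeff_sect, ← add_assoc, coeff_succ_X_mul]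

lemma sect_dilate_mul {r : ℕ} (hr : r < 5) (h f : ℂ⟦X⟧) :
    sect r (dilate h * f) = h * sect r f := by
  ext n
  rw [coeff_sect, coeff_mul, coeff_mul]
  symm
  refine sum_of_injOn (fun p ↦ (5 * p.1, 5 * p.2 + r)) ?_ ?_ ?_ ?_
  · rintro ⟨a, b⟩ - ⟨c, d⟩ - h
    simp only [Prod.mk.injEq] at h ⊢
    lia
  · rintro ⟨a, b⟩ h
    simp only [mem_coe, HasAntidiagonal.mem_antidiagonal] at h ⊢
    lia
  · rintro ⟨a, b⟩ h h'
    simp only [HasAntidiagonal.mem_antidiagonal, Set.mem_image, mem_coe, Prod.exists, Prod.mk.injEq,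
      not_exists, not_and] at h h'
    by_cases ha : 5 ∣ a
    · obtain ⟨a, rfl⟩ := ha
      exact absurd (by lia) (h' a (n - a) (by lia) rfl)
    · rw [coeff_dilate_of_not_dvd _ ha, zero_mul]
  · rintro ⟨a, b⟩ -
    rw [coeff_dilate_mul, coeff_sect]

lemma sect_X_pow_mul_dilate {r e : ℕ} (hr : r < 5) (he : e < 5) (f : ℂ⟦X⟧) :
    sect r (X ^ e * dilate f) = if e = r then f else 0 := by
  rw [mul_comm, sect_dilate_mul hr]
  have : sect r (X ^ e) = if e = r then 1 else 0 := by
    ext n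
    rw [coeff_sect, coeff_X_pow]
    split_ifs <;> simp [coeff_one] <;> lia
  rw [this, mul_ite, mul_one, mul_zero]

lemma hasSum_sect {ι : Type*} (r : ℕ) {f : ι → ℂ⟦X⟧} {s : ℂ⟦X⟧} (h : HasSum f s) :
    HasSum (fun i ↦ sect r (f i)) (sect r s) := by
  rw [HasSum, SummationFilter.unconditional_filter, WithPiTopology.tendsto_iff_coeff_tendsto] at h ⊢
  intro d
  simp_rw [← map_sum, coeff_sect]
  exact h _

lemma hasSum_int_of_mod_five {S : Type*} [AddCommMonoid S] [TopologicalSpace S] [ContinuousAdd S]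
    {f : ℤ → S} {s₀ s₁ s₂ s₃ s₄ : S} (h₀ : HasSum (fun j ↦ f (5 * j)) s₀)
    (h₁ : HasSum (fun j ↦ f (5 * j + 1)) s₁) (h₂ : HasSum (fun j ↦ f (5 * j + 2)) s₂)
    (h₃ : HasSum (fun j ↦ f (-(5 * j) - 2)) s₃) (h₄ : HasSum (fun j ↦ f (-(5 * j) - 1)) s₄) :
    HasSum f (s₀ + s₁ + s₂ + s₃ + s₄) := by
  have key {g : ℤ → ℤ} (hg : Function.Injective g) {s : S} (h : HasSum (fun j ↦ f (g j)) s) :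
      HasSum ((Set.range g).indicator f) s := by
    rw [← hasSum_subtype_iff_indicator]
    exact hg.hasSum_range_iff.mpr h
  have i₀ := key (fun a b (h : 5 * a = 5 * b) ↦ by lia) h₀
  have i₁ := key (fun a b (h : 5 * a + 1 = 5 * b + 1) ↦ by lia) h₁
  have i₂ := key (fun a b (h : 5 * a + 2 = 5 * b + 2) ↦ by lia) h₂
  have i₃ := key (fun a b (h : -(5 * a) - 2 = -(5 * b) - 2) ↦ by lia) h₃
  have i₄ := key (fun a b (h : -(5 * a) - 1 = -(5 * b) - 1) ↦ by lia) h₄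
  refine (congrArg (HasSum · _) (funext fun k ↦ ?_)).mp ((((i₀.add i₁).add i₂).add i₃).add i₄)
  classical
  simp only [Set.indicator_apply, Set.mem_range]
  have e₀ : (∃ y : ℤ, 5 * y = k) ↔ k % 5 = 0 := ⟨by lia, fun h ↦ ⟨k / 5, by lia⟩⟩
  have e₁ : (∃ y : ℤ, 5 * y + 1 = k) ↔ k % 5 = 1 := ⟨by lia, fun h ↦ ⟨k / 5, by lia⟩⟩
  have e₂ : (∃ y : ℤ, 5 * y + 2 = k) ↔ k % 5 = 2 := ⟨by lia, fun h ↦ ⟨k / 5, by lia⟩⟩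
  have e₃ : (∃ y : ℤ, -(5 * y) - 2 = k) ↔ k % 5 = 3 := ⟨by lia, fun h ↦ ⟨-(k / 5) - 1, by lia⟩⟩
  have e₄ : (∃ y : ℤ, -(5 * y) - 1 = k) ↔ k % 5 = 4 := ⟨by lia, fun h ↦ ⟨-(k / 5) - 1, by lia⟩⟩
  simp only [e₀, e₁, e₂, e₃, e₄]
  have : k % 5 = 0 ∨ k % 5 = 1 ∨ k % 5 = 2 ∨ k % 5 = 3 ∨ k % 5 = 4 := by lia
  rcases this with h | h | h | h | h <;> simp [h]

end Sections

section Dissection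

/-- The theta series `∑ (-1)ʲ q^{j * (5 * j + 1) / 2}`, as a product. -/
noncomputable def thetaA : ℂ⟦X⟧ := qprod (X ^ 3) (X ^ 5) * qprod (X ^ 2) (X ^ 5) * qprod (X ^ 5) (X ^ 5)

/-- The theta series `∑ (-1)ʲ q^{j * (5 * j + 3) / 2}`, as a product. -/
noncomputable def thetaB : ℂ⟦X⟧ := qprod (X ^ 4) (X ^ 5) * qprod X (X ^ 5) * qprod (X ^ 5) (X ^ 5)

lemma hasSum_thetaA : HasSum (thetaTerm (X ^ 3 : ℂ⟦X⟧) (X ^ 2)) thetaA := by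
  have h : (X ^ 3 * X ^ 2 : ℂ⟦X⟧) = X ^ 5 := by ring
  have := hasSum_thetaTerm (a := (X ^ 3 : ℂ⟦X⟧)) (b := X ^ 2) (by rw [h]; exact dvd_pow_self _ (by simp))
  rwa [h] at this

lemma hasSum_thetaB : HasSum (thetaTerm (X ^ 4 : ℂ⟦X⟧) X) thetaB := by
  have h : (X ^ 4 * X : ℂ⟦X⟧) = X ^ 5 := by ring
  have := hasSum_thetaTerm (a := (X ^ 4 : ℂ⟦X⟧)) (b := X) (Dvd.intro_left _ rfl)
  rwa [h] at this

lemma thetaA_mul_thetaB : thetaA * thetaB = eulerProd 1 * dilate (eulerProd 1) := by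
  rw [eulerProd_one, dilate_qprod _ (dvd_refl X), dilate_X, qprod_eq_qprod_pow_five X (dvd_refl X),
    thetaA, thetaB, ← pow_two, ← pow_succ', ← pow_succ', ← pow_succ']
  ring

lemma hasSum_thetaSummand_one : HasSum (thetaSummand 1) 0 := by
  simpa using hasSum_thetaSummand one_ne_zero

lemma hasSum_mul_thetaSummand_one :
    HasSum (fun k : ℤ ↦ C (k : ℂ) * thetaSummand 1 k) (eulerProd 1 ^ 3) := by
  have := hasSum_mul_thetaSummand one_ne_zero
  simp only [inv_one, map_one, sub_self, zero_mul, zero_add, one_mul] at this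
  rwa [pow_three']

lemma C_neg_one_zpow (j : ℤ) : (C ((-1) ^ j) : ℂ⟦X⟧) = ((j.negOnePow : ℤ) : ℂ⟦X⟧) := by
  rw [← Int.cast_negOnePow, map_intCast]

lemma thetaSummand_eq (z : ℂ) {k : ℤ} {e : ℕ} (h : 2 * (e : ℤ) = k * (k + 1)) :
    thetaSummand z k = C ((-1) ^ k * z ^ k) * X ^ e := by
  have := two_mul_triangle k
  rw [thetaSummand, show (k * (k + 1) / 2).toNat = e by lia]

variable {z : ℂ}

lemma zpow_five_mul (h5 : z ^ 5 = 1) (j : ℤ) : z ^ (5 * j) = 1 := by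
  rw [zpow_mul, zpow_ofNat, h5, one_zpow]

lemma neg_one_zpow_five_mul (j : ℤ) : (-1 : ℂ) ^ (5 * j) = (-1) ^ j := by
  rw [zpow_mul, zpow_ofNat]
  norm_num

lemma ne_zero_of_pow_five_eq_one (h5 : z ^ 5 = 1) : z ≠ 0 := by
  rintro rfl
  norm_num at h5

lemma dilate_thetaTerm_A (j : ℤ) : dilate (thetaTerm (X ^ 3) (X ^ 2) j) =
    C ((-1) ^ j) * X ^ (5 * (3 * (j * (j + 1) / 2).toNat + 2 * (j * (j - 1) / 2).toNat)) := by
  rw [thetaTerm, ← C_neg_one_zpow]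
  simp only [map_mul, map_pow, dilate_X, dilate_C]
  ring

lemma dilate_thetaTerm_B (j : ℤ) : dilate (thetaTerm (X ^ 4) X j) =
    C ((-1) ^ j) * X ^ (5 * (4 * (j * (j + 1) / 2).toNat + (j * (j - 1) / 2).toNat)) := by
  rw [thetaTerm, ← C_neg_one_zpow]
  simp only [map_mul, map_pow, dilate_X, dilate_C]
  ring

lemma thetaSummand_mod_five_zero (h5 : z ^ 5 = 1) (j : ℤ) :
    thetaSummand z (5 * j) = dilate (thetaTerm (X ^ 3) (X ^ 2) j) := by
  have e1 := two_mul_triangle j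
  have e2 := two_mul_triangle' j
  rw [dilate_thetaTerm_A, thetaSummand_eq, zpow_five_mul h5, neg_one_zpow_five_mul, mul_one]
  push_cast
  linear_combination 15 * e1 + 10 * e2

lemma thetaSummand_mod_five_one (h5 : z ^ 5 = 1) (j : ℤ) :
    thetaSummand z (5 * j + 1) = -C z * (X * dilate (thetaTerm (X ^ 4) X j)) := by
  have hz := ne_zero_of_pow_five_eq_one h5
  have e1 := two_mul_triangle j
  have e2 := two_mul_triangle' j
  rw [dilate_thetaTerm_B, thetaSummand_eq z
    (e := 5 * (4 * (j * (j + 1) / 2).toNat + (j * (j - 1) / 2).toNat) + 1), zpow_add₀ hz,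
    zpow_add₀ (by norm_num), zpow_five_mul h5, neg_one_zpow_five_mul]
  · simp only [zpow_one, map_mul, map_neg, map_one]
    ring
  · push_cast
    linear_combination 20 * e1 + 5 * e2

lemma thetaSummand_mod_five_two (h5 : z ^ 5 = 1) (j : ℤ) :
    thetaSummand z (5 * j + 2) = C (z ^ 2) * (X ^ 3 * dilate (dilate (thetaSummand 1 j))) := by
  have hz := ne_zero_of_pow_five_eq_one h5
  have e1 := two_mul_triangle j
  rw [thetaSummand_eq z (e := 5 * (5 * (j * (j + 1) / 2).toNat) + 3), zpow_add₀ hz,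
    zpow_add₀ (by norm_num), zpow_five_mul h5, neg_one_zpow_five_mul, thetaSummand]
  · simp only [map_mul, map_pow, dilate_C, dilate_X, one_zpow, zpow_ofNat, map_one, map_neg]
    ring
  · push_cast
    linear_combination 25 * e1

lemma thetaSummand_mod_five_three (h5 : z ^ 5 = 1) (j : ℤ) :
    thetaSummand z (-(5 * j) - 2) = C (z⁻¹ ^ 2) * (X * dilate (thetaTerm (X ^ 4) X j)) := by
  have hz := ne_zero_of_pow_five_eq_one h5
  have e1 := two_mul_triangle j
  have e2 := two_mul_triangle' j
  rw [dilate_thetaTerm_B, thetaSummand_eq z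
    (e := 5 * (4 * (j * (j + 1) / 2).toNat + (j * (j - 1) / 2).toNat) + 1), zpow_sub₀ hz,
    zpow_sub₀ (by norm_num), zpow_neg, zpow_neg, zpow_five_mul h5, neg_one_zpow_five_mul]
  · rw [← inv_zpow, show (-1 : ℂ)⁻¹ = -1 by norm_num]
    simp only [zpow_ofNat, map_mul, inv_one, one_div, inv_pow]
    norm_num
    ring
  · push_cast
    linear_combination 20 * e1 + 5 * e2

lemma thetaSummand_mod_five_four (h5 : z ^ 5 = 1) (j : ℤ) :
    thetaSummand z (-(5 * j) - 1) = -C z⁻¹ * dilate (thetaTerm (X ^ 3) (X ^ 2) j) := by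
  have hz := ne_zero_of_pow_five_eq_one h5
  have e1 := two_mul_triangle j
  have e2 := two_mul_triangle' j
  rw [dilate_thetaTerm_A, thetaSummand_eq z
    (e := 5 * (3 * (j * (j + 1) / 2).toNat + 2 * (j * (j - 1) / 2).toNat)), zpow_sub₀ hz,
    zpow_sub₀ (by norm_num), zpow_neg, zpow_neg, zpow_five_mul h5, neg_one_zpow_five_mul]
  · rw [← inv_zpow, show (-1 : ℂ)⁻¹ = -1 by norm_num]
    simp only [zpow_one, map_mul, inv_one, one_div, div_neg, div_one, map_neg]
    ring
  · push_cast
    linear_combination 15 * e1 + 10 * e2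

/-- The theta series at a fifth root of unity, split according to exponents modulo five. -/
lemma hasSum_thetaSummand_root (h5 : z ^ 5 = 1) :
    HasSum (thetaSummand z)
      (C (1 - z⁻¹) * dilate thetaA + C (z⁻¹ ^ 2 - z) * (X * dilate thetaB)) := by
  have hA := hasSum_dilate hasSum_thetaA
  have hB := (hasSum_dilate hasSum_thetaB).mul_left X
  have h2 := ((hasSum_dilate (hasSum_dilate hasSum_thetaSummand_one)).mul_left (X ^ 3)).mul_left
    (C (z ^ 2))
  have h0 := hasSum_int_of_mod_five (f := thetaSummand z)
    (by simpa only [thetaSummand_mod_five_zero h5] using hA)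
    (by simpa only [thetaSummand_mod_five_one h5] using hB.mul_left (-C z))
    (by simpa only [thetaSummand_mod_five_two h5] using h2)
    (by simpa only [thetaSummand_mod_five_three h5] using hB.mul_left (C (z⁻¹ ^ 2)))
    (by simpa only [thetaSummand_mod_five_four h5] using hA.mul_left (-C z⁻¹))
  convert h0 using 1
  simp only [map_sub, map_zero, map_one]
  ring

/-- The sum of `k (-z)ᵏ q^{k(k+1)/2}`. -/
noncomputable def thetaDeriv (z : ℂ) : ℂ⟦X⟧ :=
  (1 - C z⁻¹) * eulerProd 1 * eulerWronskian z z⁻¹ +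
    C z⁻¹ * eulerProd 1 * eulerProd z * eulerProd z⁻¹

lemma hasSum_sect_thetaDeriv (hz : z ≠ 0) (r : ℕ) :
    HasSum (fun k : ℤ ↦ C (k : ℂ) * sect r (thetaSummand z k)) (sect r (thetaDeriv z)) := by
  simpa only [sect_C_mul, thetaDeriv] using hasSum_sect r (hasSum_mul_thetaSummand hz)

lemma sect_thetaSummand_eq_zero {r : ℕ} (z : ℂ) {k : ℤ}
    (h : ∀ e : ℕ, 2 * (e : ℤ) = k * (k + 1) → e % 5 ≠ r) (hr : r < 5) :
    sect r (thetaSummand z k) = 0 := by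
  rw [thetaSummand, sect_C_mul]
  have h2 := h _ (two_mul_triangle k)
  ext n
  rw [coeff_C_mul, coeff_sect, coeff_X_pow, if_neg (by lia), mul_zero, map_zero]

lemma triangle_mod_five {e : ℕ} {k : ℤ} (h : 2 * (e : ℤ) = k * (k + 1)) :
    (k % 5 = 2 ∧ e % 5 = 3) ∨ (k % 5 ≠ 2 ∧ (e % 5 = 0 ∨ e % 5 = 1)) := by
  have h1 : 2 * (e : ℤ) % 5 = (k % 5) * (k % 5 + 1) % 5 := by
    rw [h]
    exact ((Int.mod_modEq k 5).mul ((Int.mod_modEq k 5).add_right 1)).symm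
  have : k % 5 = 0 ∨ k % 5 = 1 ∨ k % 5 = 2 ∨ k % 5 = 3 ∨ k % 5 = 4 := by lia
  rcases this with h | h | h | h | h <;> rw [h] at h1 <;> lia

lemma sect_thetaDeriv_eq_zero (hz : z ≠ 0) {r : ℕ} (hr : r = 2 ∨ r = 4) :
    sect r (thetaDeriv z) = 0 := by
  refine (hasSum_sect_thetaDeriv hz r).unique ?_
  convert hasSum_zero with k
  rw [sect_thetaSummand_eq_zero z _ (by lia), mul_zero]
  intro e he
  have := triangle_mod_five he
  lia

lemma sect_three_thetaDeriv (h5 : z ^ 5 = 1) :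
    sect 3 (thetaDeriv z) = C (5 * z ^ 2) * dilate (eulerProd 1 ^ 3) := by
  have hz := ne_zero_of_pow_five_eq_one h5
  refine (hasSum_sect_thetaDeriv hz 3).unique ?_
  have hinj : Function.Injective (fun j : ℤ ↦ 5 * j + 2) := fun a b h ↦ by
    simp only at h
    lia
  rw [← hinj.hasSum_iff]
  · have h1 := ((hasSum_dilate hasSum_mul_thetaSummand_one).mul_left (C (5 * z ^ 2))).add
      ((hasSum_dilate hasSum_thetaSummand_one).mul_left (C (2 * z ^ 2)))
    rw [map_zero, mul_zero, add_zero] at h1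
    refine (congrArg (HasSum · _) (funext fun j ↦ ?_)).mpr h1
    rw [Function.comp_apply, thetaSummand_mod_five_two h5, sect_C_mul,
      sect_X_pow_mul_dilate (by norm_num) (by norm_num), if_pos rfl]
    simp only [map_mul, dilate_C, Int.cast_add, Int.cast_mul, map_add, Int.cast_ofNat]
    ring
  · intro k hk
    rw [sect_thetaSummand_eq_zero z _ (by norm_num), mul_zero]
    intro e he
    have h1 : k % 5 ≠ 2 := fun h ↦ hk ⟨k / 5, by simp only; lia⟩
    have := triangle_mod_five he
    lia

end Dissection

section CrankModFive

variable {z : ℂ}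

/-- The theta series `∑ (-z)ᵏ q^{k(k+1)/2}`, as a product. -/
noncomputable def thetaProd (z : ℂ) : ℂ⟦X⟧ :=
  (1 - C z⁻¹) * eulerProd 1 * eulerProd z * eulerProd z⁻¹

lemma thetaProd_eq_of_pow_five_eq_one (h5 : z ^ 5 = 1) :
    thetaProd z = C (1 - z⁻¹) * dilate thetaA + C (z⁻¹ ^ 2 - z) * (X * dilate thetaB) :=
  (hasSum_thetaSummand (ne_zero_of_pow_five_eq_one h5)).unique (hasSum_thetaSummand_root h5)

lemma sect_thetaProd_eq_zero (h5 : z ^ 5 = 1) {r : ℕ} (hr : 1 < r) (hr' : r < 5) :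
    sect r (thetaProd z) = 0 := by
  have hA := sect_X_pow_mul_dilate hr' (by norm_num : 0 < 5) thetaA
  have hB := sect_X_pow_mul_dilate hr' (by norm_num : 1 < 5) thetaB
  rw [if_neg (by lia), pow_zero, one_mul] at hA
  rw [if_neg (by lia), pow_one] at hB
  rw [thetaProd_eq_of_pow_five_eq_one h5, map_add, sect_C_mul, sect_C_mul, hA, hB, mul_zero,
    mul_zero, add_zero]

/-- The odd part in the crank of the generating function of the number of ones. -/
noncomputable def crankDiff (z : ℂ) : ℂ⟦X⟧ := crankGenFun z z⁻¹ - crankGenFun z⁻¹ z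

lemma crankDiff_mul_eq (h5 : z ^ 5 = 1) (hz : z ≠ 1) :
    C ((1 - z⁻¹) ^ 2 * (1 - z⁻¹ ^ 2) ^ 2) * (dilate (eulerProd 1 ^ 2) * crankDiff z) =
      (C (1 - z⁻¹) * thetaDeriv z - C z⁻¹ * thetaProd z) * thetaProd (z ^ 2) ^ 2 := by
  have hz0 := ne_zero_of_pow_five_eq_one h5
  have h1 := crankGenFun_sub_crankGenFun (mul_inv_cancel₀ hz0)
  have h2 := eulerProd_root_mul h5 hz
  have e4 : z ^ 4 = z⁻¹ := eq_inv_of_mul_eq_one_left (by rw [← h5]; ring)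
  have e3 : z ^ 3 = (z ^ 2)⁻¹ := eq_inv_of_mul_eq_one_left (by rw [← h5]; ring)
  rw [e3, e4] at h2
  rw [map_pow, ← h2, crankDiff, thetaDeriv, thetaProd, thetaProd, inv_pow]
  simp only [map_mul, map_sub, map_one, map_pow]
  linear_combination (1 - C z⁻¹) ^ 2 * (1 - C (z ^ 2)⁻¹) ^ 2 * eulerProd 1 ^ 2 *
    eulerProd (z ^ 2) ^ 2 * eulerProd (z ^ 2)⁻¹ ^ 2 * h1

lemma sect_four_crankDiff (h5 : z ^ 5 = 1) (hz : z ≠ 1) :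
    C (z - z⁻¹) * sect 4 (crankDiff z) * eulerProd 1 = -10 * dilate (eulerProd 1) ^ 4 := by
  have hz0 := ne_zero_of_pow_five_eq_one h5
  have h := congrArg (sect 4) (crankDiff_mul_eq h5 hz)
  set F := C (1 - z⁻¹) * thetaDeriv z - C z⁻¹ * thetaProd z with hF
  have hF0 {r : ℕ} (hr : r = 2 ∨ r = 4) : sect r F = 0 := by
    rw [hF, map_sub, sect_C_mul, sect_C_mul, sect_thetaDeriv_eq_zero hz0 hr,
      sect_thetaProd_eq_zero h5 (by lia) (by lia), mul_zero, mul_zero, sub_zero]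
  have hF3 : sect 3 F = C (1 - z⁻¹) * (C (5 * z ^ 2) * dilate (eulerProd 1 ^ 3)) := by
    rw [hF, map_sub, sect_C_mul, sect_C_mul, sect_three_thetaDeriv h5,
      sect_thetaProd_eq_zero h5 (by lia) (by lia), mul_zero, sub_zero]
  set a : ℂ := 1 - (z ^ 2)⁻¹
  set b : ℂ := (z ^ 2)⁻¹ ^ 2 - z ^ 2
  have hexp : F * thetaProd (z ^ 2) ^ 2 = C (a ^ 2) * (dilate (thetaA ^ 2) * F) +
      C (2 * a * b) * (dilate (thetaA * thetaB) * (X * F)) +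
      C (b ^ 2) * (dilate (thetaB ^ 2) * (X * (X * F))) := by
    rw [thetaProd_eq_of_pow_five_eq_one (by rw [← pow_mul, mul_comm, pow_mul, h5, one_pow])]
    simp only [map_mul, map_pow, map_ofNat]
    ring
  have h4 : 4 < 5 := by norm_num
  simp only [hexp, map_add, sect_C_mul, sect_dilate_mul h4] at h
  rw [sect_succ_X_mul 3 F, sect_succ_X_mul 3 (X * F), sect_succ_X_mul 2 F, hF0 (.inl rfl),
    hF0 (.inr rfl), hF3, thetaA_mul_thetaB] at h
  have hE := (isUnit_eulerProd 1).ne_zero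
  have hw : 1 - z⁻¹ ≠ 0 := sub_ne_zero.mpr fun h ↦ hz (by simpa using h.symm)
  have e4 : z⁻¹ = z ^ 4 := (eq_inv_of_mul_eq_one_left (by rw [← h5]; ring)).symm
  have e3 : (z ^ 2)⁻¹ = z ^ 3 := (eq_inv_of_mul_eq_one_left (by rw [← h5]; ring)).symm
  have hw2 : 1 - z⁻¹ ^ 2 ≠ 0 := by
    refine sub_ne_zero.mpr fun h ↦ hz ?_
    rw [e4] at h
    linear_combination -(z ^ 3 + 1) * h - ((z ^ 3 + 1) * z ^ 3 + z) * h5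
  have hc : z * (2 * a * b * (1 - z⁻¹) * (5 * z ^ 2)) = -10 * ((1 - z⁻¹) ^ 2 * (1 - z⁻¹ ^ 2)) := by
    simp only [a, b, e3, e4]
    linear_combination 10 * (1 - z ^ 4) * ((1 - z ^ 3) * (z ^ 4 - 1) - z ^ 3 * (1 - z ^ 4)) * h5
  have hc' : z * ((1 - z⁻¹) ^ 2 * (1 - z⁻¹ ^ 2) ^ 2) =
      (z - z⁻¹) * ((1 - z⁻¹) ^ 2 * (1 - z⁻¹ ^ 2)) := by
    linear_combination -z⁻¹ * ((1 - z⁻¹) ^ 2 * (1 - z⁻¹ ^ 2)) * mul_inv_cancel₀ hz0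
  have hC : C ((1 - z⁻¹) ^ 2 * (1 - z⁻¹ ^ 2)) ≠ (0 : ℂ⟦X⟧) := by
    rw [← map_zero (C (R := ℂ))]
    exact fun h ↦ mul_ne_zero (pow_ne_zero _ hw) hw2 (C_injective h)
  refine mul_left_cancel₀ (mul_ne_zero hC hE) ?_
  replace hc := congrArg (C (R := ℂ)) hc
  replace hc' := congrArg (C (R := ℂ)) hc'
  simp only [map_mul, map_pow, map_neg, map_ofNat, map_sub, map_one] at h hc hc' ⊢
  linear_combination C z * h - eulerProd 1 ^ 2 * sect 4 (crankDiff z) * hc' +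
    eulerProd 1 * dilate (eulerProd 1) ^ 4 * hc

end CrankModFive

section RootOfUnityFilter

lemma zpow_emod_five {z : ℂ} (h5 : z ^ 5 = 1) (c : ℤ) : z ^ c = z ^ (c % 5) := by
  conv_lhs => rw [← Int.mul_ediv_add_emod c 5, zpow_add₀ (ne_zero_of_pow_five_eq_one h5),
    zpow_five_mul h5, one_mul]

lemma root_of_unity_filter {z : ℂ} (h5 : z ^ 5 = 1) (hz : z ≠ 1) (c : ℤ) :
    (z⁻¹ ^ 2 - z ^ 2) * (z ^ c - z⁻¹ ^ c) + (z - z⁻¹) * ((z ^ 2) ^ c - (z ^ 2)⁻¹ ^ c) =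
      5 * ((if c % 5 = 2 then 1 else 0) - (if c % 5 = 3 then 1 else 0)) := by
  have h0 : 1 + z + z ^ 2 + z ^ 3 + z ^ 4 = 0 := by
    refine mul_left_cancel₀ (sub_ne_zero.mpr hz) ?_
    linear_combination h5
  have e4 : z⁻¹ = z ^ 4 := (eq_inv_of_mul_eq_one_left (by rw [← h5]; ring)).symm
  have e3 : (z ^ 2)⁻¹ = z ^ 3 := (eq_inv_of_mul_eq_one_left (by rw [← h5]; ring)).symm
  have hpow (m : ℕ) : (z ^ m) ^ 5 = 1 := by rw [← pow_mul, mul_comm, pow_mul, h5, one_pow]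
  rw [e3, e4, zpow_emod_five h5, zpow_emod_five (hpow 4), zpow_emod_five (hpow 2),
    zpow_emod_five (hpow 3)]
  have : c % 5 = 0 ∨ c % 5 = 1 ∨ c % 5 = 2 ∨ c % 5 = 3 ∨ c % 5 = 4 := by lia
  rcases this with h | h | h | h | h <;>
  · rw [h]
    norm_num [zpow_ofNat]
    try grind

/-- The generating function of the crank differences under consideration. -/
noncomputable def crankSeries : ℂ⟦X⟧ :=
  mk fun n ↦ ((Mw 2 5 (5 * n + 4) - Mw 3 5 (5 * n + 4) : ℤ) : ℂ)

lemma coeff_crankDiff {z : ℂ} (hz : z ≠ 0) (n : ℕ) : coeff n (crankDiff z) =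
    ∑ π : n.Partition, (omegaOnes π : ℂ) * (z ^ crank π - z⁻¹ ^ crank π) := by
  rw [crankDiff, map_sub, crankGenFun, crankGenFun, coeff_mk, coeff_mk, ← sum_sub_distrib]
  refine sum_congr rfl fun π _ ↦ ?_
  rw [crank]
  split_ifs with h
  · simp [h]
  · rw [zpow_sub₀ hz, zpow_sub₀ (inv_ne_zero hz)]
    simp only [zpow_natCast, inv_pow, div_eq_mul_inv, inv_inv]
    ring

lemma five_mul_crankSeries {z : ℂ} (h5 : z ^ 5 = 1) (hz : z ≠ 1) :
    5 * crankSeries = C (z⁻¹ ^ 2 - z ^ 2) * sect 4 (crankDiff z) +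
      C (z - z⁻¹) * sect 4 (crankDiff (z ^ 2)) := by
  have hz0 := ne_zero_of_pow_five_eq_one h5
  ext n
  rw [← map_ofNat (C (R := ℂ)), map_add, coeff_C_mul, coeff_C_mul, coeff_C_mul, coeff_sect, coeff_sect,
    coeff_crankDiff hz0, coeff_crankDiff (pow_ne_zero 2 hz0), mul_sum, mul_sum,
    ← sum_add_distrib, crankSeries, coeff_mk, Mw, Mw, ← sum_sub_distrib, Int.cast_sum, mul_sum]
  refine sum_congr rfl fun π _ ↦ ?_
  have h := root_of_unity_filter h5 hz (crank π)
  simp only [Nat.cast_ofNat, Int.reduceMod, Int.cast_sub, Int.cast_ite, Int.cast_natCast,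
    Int.cast_zero]
  split_ifs at h ⊢ <;> linear_combination -(omegaOnes π : ℂ) * h

lemma crankSeries_mul_eulerProd : crankSeries * eulerProd 1 = -2 * dilate (eulerProd 1) ^ 4 := by
  have hprim := Complex.isPrimitiveRoot_exp 5 (by norm_num)
  set z := Complex.exp (2 * Real.pi * Complex.I / (5 : ℕ))
  have h5 : z ^ 5 = 1 := hprim.pow_eq_one
  have hz : z ≠ 1 := hprim.ne_one (by norm_num)
  have hz2 : z ^ 2 ≠ 1 := hprim.pow_ne_one_of_pos_of_lt (by norm_num) (by norm_num)
  have hz0 := ne_zero_of_pow_five_eq_one h5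
  have h1 := sect_four_crankDiff h5 hz
  have h2 := sect_four_crankDiff (z := z ^ 2)
    (by rw [← pow_mul, mul_comm, pow_mul, h5, one_pow]) hz2
  have h3 := five_mul_crankSeries h5 hz
  have e4 : z⁻¹ = z ^ 4 := (eq_inv_of_mul_eq_one_left (by rw [← h5]; ring)).symm
  have e3 : (z ^ 2)⁻¹ = z ^ 3 := (eq_inv_of_mul_eq_one_left (by rw [← h5]; ring)).symm
  have hst : (z - z⁻¹) * (z ^ 2 - (z ^ 2)⁻¹) = (z - z⁻¹) ^ 2 - (z ^ 2 - (z ^ 2)⁻¹) ^ 2 := by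
    rw [e3, e4]
    grind
  have hs : z - z⁻¹ ≠ 0 := by
    rw [e4]
    grind
  have ht : z ^ 2 - (z ^ 2)⁻¹ ≠ 0 := by
    rw [e3]
    grind
  have hC : 5 * C ((z - z⁻¹) * (z ^ 2 - (z ^ 2)⁻¹)) ≠ (0 : ℂ⟦X⟧) := by
    rw [← map_ofNat (C (R := ℂ)), ← map_mul, ← map_zero (C (R := ℂ))]
    exact fun h ↦ mul_ne_zero (by norm_num) (mul_ne_zero hs ht) (C_injective h)
  refine mul_left_cancel₀ hC ?_
  replace hst := congrArg (C (R := ℂ)) hst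
  rw [inv_pow] at h3
  simp only [map_mul, map_sub, map_pow] at h1 h2 h3 hst ⊢
  linear_combination (C z - C z⁻¹) * (C z ^ 2 - C (z ^ 2)⁻¹) * eulerProd 1 * h3 -
    (C z ^ 2 - C (z ^ 2)⁻¹) ^ 2 * h1 + (C z - C z⁻¹) ^ 2 * h2 +
    10 * dilate (eulerProd 1) ^ 4 * hst

end RootOfUnityFilter

section Analytic

open Filter Topology

/-- The power series `f` converges to `F` on the open unit disc. -/
def Represents (f : ℂ⟦X⟧) (F : ℂ → ℂ) : Prop :=
  ∀ q : ℂ, ‖q‖ < 1 → HasSum (fun n ↦ coeff n f * q ^ n) (F q)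

namespace Represents

variable {f g : ℂ⟦X⟧} {F G : ℂ → ℂ}

lemma mul (hf : Represents f F) (hg : Represents g G) :
    Represents (f * g) fun q ↦ F q * G q := by
  intro q hq
  have hf' := (hf q hq).summable.norm
  have hg' := (hg q hq).summable.norm
  have h : (fun n ↦ coeff n (f * g) * q ^ n) = fun n ↦ ∑ kl ∈ antidiagonal n,
      (coeff kl.1 f * q ^ kl.1) * (coeff kl.2 g * q ^ kl.2) := by
    ext n
    rw [coeff_mul, sum_mul]
    refine sum_congr rfl fun kl hkl ↦ ?_
    rw [← mem_antidiagonal.mp hkl, pow_add]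
    ring
  dsimp only
  rw [h, ← (hf q hq).tsum_eq, ← (hg q hq).tsum_eq,
    tsum_mul_tsum_eq_tsum_sum_antidiagonal_of_summable_norm hf' hg']
  exact (summable_norm_sum_mul_antidiagonal_of_summable_norm hf' hg').of_norm.hasSum

lemma smul (hf : Represents f F) (c : ℂ) : Represents (c • f) fun q ↦ c * F q := by
  intro q hq
  simpa [mul_assoc] using (hf q hq).mul_left c

lemma dilate (hf : Represents f F) : Represents (dilate f) fun q ↦ F (q ^ 5) := by
  intro q hq
  have h := hf (q ^ 5) (by rw [norm_pow]; exact pow_lt_one₀ (norm_nonneg q) hq (by norm_num))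
  have hinj : Function.Injective fun n : ℕ ↦ 5 * n := fun a b h ↦ by simpa using h
  rw [← hinj.hasSum_iff]
  · convert h using 2 with n
    have := coeff_dilate_mul f n
    simp only [Function.comp_apply, this, pow_mul]
  · intro n hn
    rw [coeff_dilate_of_not_dvd, zero_mul]
    rintro ⟨m, rfl⟩
    exact hn ⟨m, rfl⟩

lemma unique (hf : Represents f F) (hg : Represents g F) : f = g := by
  have key {h : ℂ⟦X⟧} (hh : Represents h F) :
      HasFPowerSeriesAt F (FormalMultilinearSeries.ofScalars ℂ fun n ↦ coeff n h) 0 := by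
    rw [hasFPowerSeriesAt_iff]
    filter_upwards [Metric.ball_mem_nhds (0 : ℂ) one_pos] with z hz
    simpa [mul_comm] using hh z (by simpa using hz)
  ext n
  simpa using congrArg (fun p ↦ p.coeff n) ((key hf).eq_formalMultilinearSeries (key hg))

lemma differentiableOn (hf : Represents f F) : DifferentiableOn ℂ F (Metric.ball 0 1) := by
  intro q hq
  obtain ⟨r, hqr, hr⟩ := exists_between (mem_ball_zero_iff.mp hq)
  have hr0 : 0 ≤ r := (norm_nonneg q).trans hqr.le
  have hs : Summable fun n ↦ ‖coeff n f‖ * r ^ n := by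
    simpa [abs_of_nonneg hr0] using (hf r (by simpa [abs_of_nonneg hr0] using hr)).summable.norm
  have hd : DifferentiableOn ℂ (fun z ↦ ∑' n, coeff n f * z ^ n) (Metric.ball 0 r) := by
    refine Complex.differentiableOn_tsum_of_summable_norm hs (fun n ↦ by fun_prop)
      Metric.isOpen_ball fun n z hz ↦ ?_
    rw [norm_mul, norm_pow]
    have := (mem_ball_zero_iff.mp hz).le
    gcongr
  have hd' : DifferentiableOn ℂ F (Metric.ball 0 r) := hd.congr fun z hz ↦
    ((hf z ((mem_ball_zero_iff.mp hz).trans hr)).tsum_eq).symm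
  exact (hd'.differentiableAt (Metric.isOpen_ball.mem_nhds
    (mem_ball_zero_iff.mpr hqr))).differentiableWithinAt

end Represents

lemma exists_represents {F : ℂ → ℂ} (hF : DifferentiableOn ℂ F (Metric.ball 0 1)) :
    ∃ f, Represents f F := by
  refine ⟨mk fun n ↦ (n.factorial : ℂ)⁻¹ * iteratedDeriv n F 0, fun q hq ↦ ?_⟩
  have h := Complex.hasSum_taylorSeries_on_ball hF (mem_ball_zero_iff.mpr hq)
  simp only [sub_zero, smul_eq_mul] at h
  simpa only [coeff_mk, mul_assoc, mul_comm (q ^ _)] using h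

lemma summable_norm_neg_mul_pow {q : ℂ} (hq : ‖q‖ < 1) :
    Summable fun n : ℕ ↦ ‖-(q * q ^ n)‖ := by
  simpa using (summable_geometric_of_lt_one (norm_nonneg q) hq).mul_left ‖q‖

lemma tendsto_prod_poch {q : ℂ} (hq : ‖q‖ < 1) :
    Tendsto (fun N ↦ ∏ k ∈ range N, (1 - q * q ^ k)) atTop (𝓝 (poch q q)) := by
  have h := (multipliable_one_add_of_summable (summable_norm_neg_mul_pow hq))
  simpa [poch, sub_eq_add_neg] using h.hasProd.tendsto_prod_nat

lemma poch_ne_zero {q : ℂ} (hq : ‖q‖ < 1) : poch q q ≠ 0 := by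
  have h : poch q q = ∏' n : ℕ, (1 + -(q * q ^ n)) := by simp only [poch, sub_eq_add_neg]
  rw [h]
  refine tprod_one_add_ne_zero_of_summable (fun i ↦ ?_) (summable_norm_neg_mul_pow hq)
  rw [← sub_eq_add_neg, sub_ne_zero, ← pow_succ']
  intro h
  have := pow_lt_one₀ (norm_nonneg q) hq i.succ_ne_zero
  rw [← norm_pow, ← h, norm_one] at this
  exact lt_irrefl _ this

/-- The Euler polynomial `∏_{k < N} (1 - X^{k+1})`. -/
noncomputable def eulerPoly (N : ℕ) : Polynomial ℂ :=
  ∏ k ∈ range N, (1 - Polynomial.X * Polynomial.X ^ k)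

lemma norm_coeff_eulerPoly_mul_pow_le {r : ℝ} (hr : 0 ≤ r) (N n : ℕ) :
    ‖(eulerPoly N).coeff n‖ * r ^ n ≤ ∏ k ∈ range N, (1 + r * r ^ k) := by
  induction N generalizing n with
  | zero =>
    rcases n with _ | n <;> simp [eulerPoly, Polynomial.coeff_one]
  | succ N ih =>
    have hc : (eulerPoly (N + 1)).coeff n =
        (eulerPoly N).coeff n - if N + 1 ≤ n then (eulerPoly N).coeff (n - (N + 1)) else 0 := by
      rw [eulerPoly, prod_range_succ, ← eulerPoly, mul_sub, mul_one, ← pow_succ',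
        Polynomial.coeff_sub, Polynomial.coeff_mul_X_pow']
    rw [prod_range_succ, hc]
    have h0 : 0 ≤ ∏ k ∈ range N, (1 + r * r ^ k) := prod_nonneg fun k _ ↦ by positivity
    refine (mul_le_mul_of_nonneg_right (norm_sub_le _ _) (by positivity)).trans ?_
    rw [add_mul, mul_add, mul_one]
    refine add_le_add (ih n) ?_
    split_ifs with h
    · calc _ = (‖(eulerPoly N).coeff (n - (N + 1))‖ * r ^ (n - (N + 1))) * (r * r ^ N) := by
            rw [mul_assoc, ← pow_succ', ← pow_add, Nat.sub_add_cancel h]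
        _ ≤ _ := mul_le_mul_of_nonneg_right (ih _) (by positivity)
    · simp only [norm_zero, zero_mul]
      positivity

lemma coeff_eulerPoly_of_lt {n N : ℕ} (h : n < N) :
    (eulerPoly N).coeff n = coeff n (eulerProd 1) := by
  have h1 := X_pow_dvd_iff.mp (X_pow_dvd_qprod_sub_prod (X : ℂ⟦X⟧) (dvd_refl X) N) n h
  have h2 : ((eulerPoly N : Polynomial ℂ) : ℂ⟦X⟧) = ∏ k ∈ range N, (1 - X * X ^ k) := by
    rw [eulerPoly, ← Polynomial.coeToPowerSeries.ringHom_apply, map_prod]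
    simp
  rw [map_sub, sub_eq_zero, ← h2, Polynomial.coeff_coe] at h1
  rw [← h1, eulerProd_one]

lemma represents_eulerProd_one : Represents (eulerProd 1) fun q ↦ poch q q := by
  intro q hq
  obtain ⟨r, hqr, hr⟩ := exists_between hq
  have hr0 : 0 < r := (norm_nonneg q).trans_lt hqr
  set M := Real.exp (∑' k : ℕ, r * r ^ k) with hM
  have hsr : Summable fun k : ℕ ↦ r * r ^ k :=
    (summable_geometric_of_lt_one hr0.le hr).mul_left r
  have hprod (N : ℕ) : ∏ k ∈ range N, (1 + r * r ^ k) ≤ M := by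
    refine (Real.prod_one_add_le_exp_sum _ fun k ↦ by positivity).trans ?_
    exact Real.exp_le_exp.mpr (hsr.sum_le_tsum _ fun k _ ↦ by positivity)
  have hbound (N n : ℕ) : ‖(eulerPoly N).coeff n * q ^ n‖ ≤ M * (‖q‖ / r) ^ n := by
    have h := (norm_coeff_eulerPoly_mul_pow_le hr0.le N n).trans (hprod N)
    calc _ = (‖(eulerPoly N).coeff n‖ * r ^ n) * (‖q‖ / r) ^ n := by
            rw [norm_mul, norm_pow, mul_assoc, ← mul_pow, mul_div_cancel₀ _ hr0.ne']
      _ ≤ _ := mul_le_mul_of_nonneg_right h (by positivity)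
  have hsum : Summable fun n ↦ M * (‖q‖ / r) ^ n :=
    (summable_geometric_of_lt_one (by positivity) ((div_lt_one hr0).mpr hqr)).mul_left M
  have hlim (n : ℕ) : (fun N ↦ (eulerPoly N).coeff n * q ^ n) =ᶠ[atTop]
      fun _ ↦ coeff n (eulerProd 1) * q ^ n := by
    filter_upwards [eventually_gt_atTop n] with N hN
    rw [coeff_eulerPoly_of_lt hN]
  have ht := tendsto_tsum_of_dominated_convergence hsum
    (fun n ↦ tendsto_const_nhds.congr' (hlim n).symm) (.of_forall hbound)
  have hev (N : ℕ) : ∑' n, (eulerPoly N).coeff n * q ^ n = ∏ k ∈ range N, (1 - q * q ^ k) := by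
    rw [tsum_eq_sum (s := range ((eulerPoly N).natDegree + 1)), ← Polynomial.eval_eq_sum_range]
    · simp [eulerPoly, Polynomial.eval_prod]
    · intro n hn
      rw [Polynomial.coeff_eq_zero_of_natDegree_lt (by simpa using hn), zero_mul]
  simp_rw [hev] at ht
  dsimp only
  rw [← tendsto_nhds_unique ht (tendsto_prod_poch hq)]
  refine (Summable.of_norm_bounded hsum fun n ↦ ?_).hasSum
  rw [← coeff_eulerPoly_of_lt n.lt_succ_self]
  exact hbound _ n

end Analytic

end Proof

/-- Identity (4.3):
`∑_{n≥0} (Mω(2,5,5n+4) − Mω(3,5,5n+4)) qⁿ = −2 (q⁵;q⁵)_∞⁴ / (q;q)_∞`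
for `|q| < 1`. -/
theorem statement_17 (q : ℂ) (hq : ‖q‖ < 1) :
    ∑' n : ℕ, ((Mw 2 5 (5 * n + 4) - Mw 3 5 (5 * n + 4) : ℤ) : ℂ) * q ^ n
      = -2 * (poch (q ^ 5) (q ^ 5)) ^ 4 / poch q q := by
  have hE := represents_eulerProd_one
  have hD : Represents (-2 * dilate (eulerProd 1) ^ 4)
      fun q ↦ -2 * (poch (q ^ 5) (q ^ 5)) ^ 4 := by
    convert ((hE.dilate.mul hE.dilate).mul (hE.dilate.mul hE.dilate)).smul (-2) using 1
    · rw [PowerSeries.smul_eq_C_mul, map_neg, map_ofNat]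
      ring
    · ext q
      ring
  obtain ⟨G, hG⟩ := exists_represents (hD.differentiableOn.div hE.differentiableOn
    fun z hz ↦ poch_ne_zero (mem_ball_zero_iff.mp hz))
  have hGE : G * eulerProd 1 = -2 * dilate (eulerProd 1) ^ 4 := by
    refine (hG.mul hE).unique fun z hz ↦ ?_
    simpa [div_mul_cancel₀ _ (poch_ne_zero hz)] using hD z hz
  rw [← crankSeries_mul_eulerProd, (isUnit_eulerProd 1).mul_left_inj] at hGE
  subst hGE
  simpa [crankSeries] using (hG q hq).tsum_eq

end Beck
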